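/- Let C be any class of weak orders such that some member F of C contains an ⟨ω+1,>⟩-type chain. Then the satisfiability problem over decreasing 2-frames with horizontal frame in C and all vertical frames difference frames — given a bimodal formula φ, is φ satisfied in some model based on such a decreasing 2-frame — is undecidable (the counter-machine non-termination problem is computably many-one reducible to it). -/

import Mathlib

namespace HK

/-! ## Bimodal formulas -/

/-- Bimodal formulas: `φ ::= P | ¬φ | φ∧ψ | ◇₀φ | ◇₁φ`. -/
inductive BForm : Type
  | var : ℕ → BForm
  | neg : BForm → BForm
  | and : BForm → BForm → BForm
  | dia0 : BForm → BForm
  | dia1 : BForm → BForm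

namespace BForm

def imp (φ ψ : BForm) : BForm := neg (and φ (neg ψ))
def bot : BForm := and (var 0) (neg (var 0))
def top : BForm := neg bot
def box0 (φ : BForm) : BForm := neg (dia0 (neg φ))
def box1 (φ : BForm) : BForm := neg (dia1 (neg φ))
/-- `□₀⁺φ := φ ∧ □₀φ` -/
def boxP0 (φ : BForm) : BForm := and φ (box0 φ)
/-- `□₁⁺φ := φ ∧ □₁φ` -/
def boxP1 (φ : BForm) : BForm := and φ (box1 φ)

/-- Modal nesting depth. -/
def depth : BForm → ℕ
  | var _ => 0
  | neg φ => depth φ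
  | and φ ψ => max (depth φ) (depth ψ)
  | dia0 φ => depth φ + 1
  | dia1 φ => depth φ + 1

/-- The propositional variable `k` occurs in the formula. -/
def Occurs (k : ℕ) : BForm → Prop
  | var n => k = n
  | neg φ => Occurs k φ
  | and φ ψ => Occurs k φ ∨ Occurs k ψ
  | dia0 φ => Occurs k φ
  | dia1 φ => Occurs k φ

/-- The formula uses only the modal operator `◇₀`. -/
def OnlyDia0 : BForm → Prop
  | var _ => True
  | neg φ => OnlyDia0 φ
  | and φ ψ => OnlyDia0 φ ∧ OnlyDia0 ψ
  | dia0 φ => OnlyDia0 φ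
  | dia1 _ => False

/-- The formula uses only the modal operator `◇₁`. -/
def OnlyDia1 : BForm → Prop
  | var _ => True
  | neg φ => OnlyDia1 φ
  | and φ ψ => OnlyDia1 φ ∧ OnlyDia1 ψ
  | dia0 _ => False
  | dia1 φ => OnlyDia1 φ

/-- Relativisation `φ^D` of each diamond to the variable `d`:
each subformula `◇ᵢψ` is replaced by `◇ᵢ(D ∧ ψ^D)`. -/
def relativize (d : ℕ) : BForm → BForm
  | var n => var n
  | neg φ => neg (relativize d φ)
  | and φ ψ => and (relativize d φ) (relativize d ψ)
  | dia0 φ => dia0 (and (var d) (relativize d φ))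
  | dia1 φ => dia1 (and (var d) (relativize d φ))

/-- `□₀^k φ` -/
def iterBox0 : ℕ → BForm → BForm
  | 0, φ => φ
  | n+1, φ => box0 (iterBox0 n φ)

/-- `□₁^k φ` -/
def iterBox1 : ℕ → BForm → BForm
  | 0, φ => φ
  | n+1, φ => box1 (iterBox1 n φ)

/-- `□₀^{≤n} φ := ⋀_{k ≤ n} □₀^k φ` -/
def boxLe0 : ℕ → BForm → BForm
  | 0, φ => φ
  | n+1, φ => and (boxLe0 n φ) (iterBox0 (n+1) φ)

/-- `□₁^{≤n} φ := ⋀_{k ≤ n} □₁^k φ` -/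
def boxLe1 : ℕ → BForm → BForm
  | 0, φ => φ
  | n+1, φ => and (boxLe1 n φ) (iterBox1 (n+1) φ)

/-- Uniform substitution. -/
def subst (s : ℕ → BForm) : BForm → BForm
  | var n => s n
  | neg φ => neg (subst s φ)
  | and φ ψ => and (subst s φ) (subst s ψ)
  | dia0 φ => dia0 (subst s φ)
  | dia1 φ => dia1 (subst s φ)

end BForm

/-- Kripke truth over a 2-frame `⟨W, R0, R1⟩` with valuation `val`. -/
def BSat {W : Type} (R0 R1 : W → W → Prop) (val : ℕ → W → Prop) : W → BForm → Prop
  | w, .var n => val n w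
  | w, .neg φ => ¬ BSat R0 R1 val w φ
  | w, .and φ ψ => BSat R0 R1 val w φ ∧ BSat R0 R1 val w ψ
  | w, .dia0 φ => ∃ v, R0 w v ∧ BSat R0 R1 val v φ
  | w, .dia1 φ => ∃ v, R1 w v ∧ BSat R0 R1 val v φ

/-! ## Frames -/

/-- A (unimodal) frame: a nonempty set with a binary relation. -/
structure Frame : Type 1 where
  W : Type
  R : W → W → Prop
  ne : Nonempty W

/-- A 2-frame: a nonempty set with two binary relations. -/
structure Frame2 : Type 1 where
  W : Type
  R0 : W → W → Prop
  R1 : W → W → Prop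
  ne : Nonempty W

/-- Validity of a bimodal formula in a 2-frame. -/
def Frame2.Valid (F : Frame2) (φ : BForm) : Prop :=
  ∀ (val : ℕ → F.W → Prop) (w : F.W), BSat F.R0 F.R1 val w φ

/-- Satisfaction of a bimodal formula in some model based on the 2-frame. -/
def Frame2.Sat (F : Frame2) (φ : BForm) : Prop :=
  ∃ (val : ℕ → F.W → Prop) (w : F.W), BSat F.R0 F.R1 val w φ

/-- Horizontal relation of a product frame. -/
def prodR0 {A B : Type} (R : A → A → Prop) : A × B → A × B → Prop :=
  fun p q => R p.1 q.1 ∧ p.2 = q.2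

/-- Vertical relation of a product frame. -/
def prodR1 {A B : Type} (S : B → B → Prop) : A × B → A × B → Prop :=
  fun p q => p.1 = q.1 ∧ S p.2 q.2

/-- `φ` is satisfied in some model based on the product frame `⟨A,R⟩ × ⟨B,S⟩`. -/
def ProdSat {A B : Type} (R : A → A → Prop) (S : B → B → Prop) (φ : BForm) : Prop :=
  ∃ (val : ℕ → A × B → Prop) (w : A × B), BSat (prodR0 R) (prodR1 S) val w φ

/-- `φ` is valid in the product frame `⟨A,R⟩ × ⟨B,S⟩`. -/
def ProdValid {A B : Type} (R : A → A → Prop) (S : B → B → Prop) (φ : BForm) : Prop :=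
  ∀ (val : ℕ → A × B → Prop) (w : A × B), BSat (prodR0 R) (prodR1 S) val w φ

/-- The product 2-frame of two frames. -/
def prodFrame2 (A B : Type) [Nonempty A] [Nonempty B]
    (R : A → A → Prop) (S : B → B → Prop) : Frame2 :=
  ⟨A × B, prodR0 R, prodR1 S, inferInstance⟩

/-- Linear order: irreflexive, transitive and trichotomous. -/
def IsLin {T : Type} (R : T → T → Prop) : Prop :=
  (∀ x, ¬ R x x) ∧ (∀ x y z, R x y → R y z → R x z) ∧ (∀ x y, R x y ∨ x = y ∨ R y x)

/-- Weak order: transitive and weakly connected. -/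
def WeakOrd {T : Type} (R : T → T → Prop) : Prop :=
  (∀ x y z, R x y → R y z → R x z) ∧ (∀ x y z, R x y → R x z → y = z ∨ R y z ∨ R z y)

/-- Modal discreteness. -/
def ModallyDiscrete {T : Type} (R : T → T → Prop) : Prop :=
  ¬ ∃ (x : ℕ → T) (xω : T), (∀ i, R (x i) (x (i+1))) ∧ (∀ i, x i ≠ x (i+1)) ∧
      (∀ i, R (x i) xω) ∧ (∀ i, ¬ R xω (x i))

/-- No infinite ascending chains of distinct points. -/
def Noetherian {T : Type} (R : T → T → Prop) : Prop :=
  ¬ ∃ x : ℕ → T, (∀ i, R (x i) (x (i+1))) ∧ (∀ i, x i ≠ x (i+1))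

/-- The frame is (isomorphic to) `⟨ω,<⟩`. -/
def IsOmegaFrame (F : Frame) : Prop :=
  ∃ e : F.W ≃ ℕ, ∀ a b, F.R a b ↔ e a < e b

/-- The frame is a finite linear order. -/
def IsFinLinFrame (F : Frame) : Prop := Finite F.W ∧ IsLin F.R

/-- `F` contains an `⟨ω+1,>⟩`-type chain: distinct points `x₀,…,x_n,…,x_ω` with
`x_n R x_m` iff `n > m` (for `n ≠ m`). -/
def HasOmegaPlusOneChain (F : Frame) : Prop :=
  ∃ (x : ℕ → F.W) (xω : F.W), Function.Injective x ∧ (∀ n, x n ≠ xω) ∧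
    (∀ n m, n ≠ m → (F.R (x n) (x m) ↔ m < n)) ∧
    (∀ n, F.R xω (x n)) ∧ (∀ n, ¬ F.R (x n) xω)

/-! ## Two-dimensional (expanding/decreasing) 2-frames `H_{F,Ḡ}` -/

/-- A 2-frame `H_{F,Ḡ}` built from a horizontal frame `⟨H,R⟩` and, for each `x : H`,
a vertical frame `G_x = ⟨D x, S x⟩` carved out of a common ambient type `V`. -/
structure TwoFrame : Type 1 where
  H : Type
  R : H → H → Prop
  Hne : Nonempty H
  V : Type
  D : H → Set V
  S : H → V → V → Prop
  Dne : ∀ x, (D x).Nonempty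

namespace TwoFrame

/-- The horizontal frame. -/
def horiz (T : TwoFrame) : Frame := ⟨T.H, T.R, T.Hne⟩

/-- The vertical frame `G_x` at `x`. -/
def fiber (T : TwoFrame) (x : T.H) : Frame :=
  ⟨{a : T.V // a ∈ T.D x}, fun a b => T.S x a.1 b.1,
    Exists.elim (T.Dne x) (fun a ha => ⟨⟨a, ha⟩⟩)⟩

/-- The worlds `{⟨u,v⟩ : u ∈ H, v ∈ D u}`. -/
def Worlds (T : TwoFrame) : Type := {p : T.H × T.V // p.2 ∈ T.D p.1}

/-- Horizontal relation of `H_{F,Ḡ}`. -/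
def Rh (T : TwoFrame) : T.Worlds → T.Worlds → Prop :=
  fun p q => T.R p.1.1 q.1.1 ∧ p.1.2 = q.1.2

/-- Vertical relation of `H_{F,Ḡ}`. -/
def Rv (T : TwoFrame) : T.Worlds → T.Worlds → Prop :=
  fun p q => p.1.1 = q.1.1 ∧ T.S p.1.1 p.1.2 q.1.2

/-- `φ` is satisfied in some model based on `H_{F,Ḡ}`. -/
def Sat (T : TwoFrame) (φ : BForm) : Prop :=
  ∃ (val : ℕ → T.Worlds → Prop) (w : T.Worlds), BSat T.Rh T.Rv val w φ

/-- Decreasing 2-frame: `G_y` is a subframe of `G_x` whenever `x R y`. -/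
def Decreasing (T : TwoFrame) : Prop :=
  ∀ x y, T.R x y → T.D y ⊆ T.D x ∧ ∀ a ∈ T.D y, ∀ b ∈ T.D y, (T.S y a b ↔ T.S x a b)

/-- Expanding 2-frame: `G_x` is a subframe of `G_y` whenever `x R y`. -/
def Expanding (T : TwoFrame) : Prop :=
  ∀ x y, T.R x y → T.D x ⊆ T.D y ∧ ∀ a ∈ T.D x, ∀ b ∈ T.D x, (T.S x a b ↔ T.S y a b)

/-- All vertical frames are difference frames. -/
def DiffFibers (T : TwoFrame) : Prop :=
  ∀ x, ∀ a ∈ T.D x, ∀ b ∈ T.D x, (T.S x a b ↔ a ≠ b)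

end TwoFrame

/-- `φ` is satisfied in some model based on a product of a member of `C`
with a difference frame. -/
def ProdDiffSat (C : Frame → Prop) (φ : BForm) : Prop :=
  ∃ F : Frame, C F ∧ ∃ D : Type, Nonempty D ∧ ProdSat F.R (fun a b : D => a ≠ b) φ

/-- `φ` is satisfied in some model based on a decreasing 2-frame with horizontal
frame in `C` and all vertical frames difference frames. -/
def DecDiffSat (C : Frame → Prop) (φ : BForm) : Prop :=
  ∃ T : TwoFrame, C T.horiz ∧ T.Decreasing ∧ T.DiffFibers ∧ T.Sat φ

/-- `φ` is satisfied in some model based on an expanding 2-frame with horizontal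
frame in `C` and all vertical frames difference frames. -/
def ExpDiffSat (C : Frame → Prop) (φ : BForm) : Prop :=
  ∃ T : TwoFrame, C T.horiz ∧ T.Expanding ∧ T.DiffFibers ∧ T.Sat φ

/-- `φ` is satisfied in some model based on a product of a member of `C0` with a
member of `C1`. -/
def ProdClassSat (C0 C1 : Frame → Prop) (φ : BForm) : Prop :=
  ∃ F0, C0 F0 ∧ ∃ F1, C1 F1 ∧ ProdSat F0.R F1.R φ

/-- `φ` is satisfied in some model based on a decreasing 2-frame with horizontal
frame in `C0` and all vertical frames in `C1`. -/
def DecClassSat (C0 C1 : Frame → Prop) (φ : BForm) : Prop :=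
  ∃ T : TwoFrame, C0 T.horiz ∧ (∀ x, C1 (T.fiber x)) ∧ T.Decreasing ∧ T.Sat φ

/-- `φ` is satisfied in some model based on an expanding 2-frame with horizontal
frame in `C0` and all vertical frames in `C1`. -/
def ExpClassSat (C0 C1 : Frame → Prop) (φ : BForm) : Prop :=
  ∃ T : TwoFrame, C0 T.horiz ∧ (∀ x, C1 (T.fiber x)) ∧ T.Expanding ∧ T.Sat φ

/-- Satisfiability over products of `⟨ω,<⟩` with difference frames. -/
def OmegaDiffSat (φ : BForm) : Prop :=
  ∃ D : Type, Nonempty D ∧ ProdSat (fun m n : ℕ => m < n) (fun a b : D => a ≠ b) φ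

/-- Satisfiability over products of finite linear orders with difference frames. -/
def FinLinDiffSat (φ : BForm) : Prop :=
  ∃ (T : Type) (R : T → T → Prop), Finite T ∧ IsLin R ∧
    ∃ D : Type, Nonempty D ∧ ProdSat R (fun a b : D => a ≠ b) φ

/-! ## Bimodal logics -/

/-- Propositional tautology (diamond formulas treated as atoms). -/
def IsTaut (φ : BForm) : Prop :=
  ∀ v : BForm → Prop, (∀ ψ, v (BForm.neg ψ) ↔ ¬ v ψ) →
    (∀ ψ χ, v (BForm.and ψ χ) ↔ v ψ ∧ v χ) → v φ

/-- Normal bimodal logic. -/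
structure IsLogic (L : Set BForm) : Prop where
  taut : ∀ φ, IsTaut φ → φ ∈ L
  K0 : BForm.imp (BForm.box0 (BForm.imp (BForm.var 0) (BForm.var 1)))
        (BForm.imp (BForm.box0 (BForm.var 0)) (BForm.box0 (BForm.var 1))) ∈ L
  K1 : BForm.imp (BForm.box1 (BForm.imp (BForm.var 0) (BForm.var 1)))
        (BForm.imp (BForm.box1 (BForm.var 0)) (BForm.box1 (BForm.var 1))) ∈ L
  mp : ∀ φ ψ, BForm.imp φ ψ ∈ L → φ ∈ L → ψ ∈ L
  subst : ∀ φ s, φ ∈ L → BForm.subst s φ ∈ L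
  nec0 : ∀ φ, φ ∈ L → BForm.box0 φ ∈ L
  nec1 : ∀ φ, φ ∈ L → BForm.box1 φ ∈ L

/-- Validity of a (◇₀-)formula in a unimodal frame `⟨W,R⟩`. -/
def UValid0 {W : Type} (R : W → W → Prop) (φ : BForm) : Prop :=
  ∀ (val : ℕ → W → Prop) (w : W), BSat R (fun _ _ => False) val w φ

/-- Validity of a (◇₁-)formula in a unimodal frame `⟨W,S⟩`. -/
def UValid1 {W : Type} (S : W → W → Prop) (φ : BForm) : Prop :=
  ∀ (val : ℕ → W → Prop) (w : W), BSat (fun _ _ => False) S val w φ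

/-- `K4.3`: the unimodal logic (in `◇₀`) of all linear orders. -/
def K43 : Set BForm :=
  {φ | φ.OnlyDia0 ∧ ∀ (T : Type) (R : T → T → Prop), Nonempty T → IsLin R → UValid0 R φ}

/-- `Diff`: the unimodal logic (in `◇₁`) of all difference frames. -/
def DiffLogic : Set BForm :=
  {φ | φ.OnlyDia1 ∧ ∀ (D : Type), Nonempty D → UValid1 (fun a b : D => a ≠ b) φ}

/-- `Log⟨ω,<⟩`: the unimodal logic (in `◇₀`) of the frame `⟨ω,<⟩`. -/
def LogOmega : Set BForm :=
  {φ | φ.OnlyDia0 ∧ UValid0 (fun m n : ℕ => m < n) φ}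

/-- `GL.3`: the unimodal logic (in `◇₀`) of all Noetherian irreflexive linear orders. -/
def GL3 : Set BForm :=
  {φ | φ.OnlyDia0 ∧
    ∀ (T : Type) (R : T → T → Prop), Nonempty T → IsLin R → Noetherian R → UValid0 R φ}

/-- `DisK4.3`: the unimodal logic (in `◇₀`) of all modally discrete weak orders. -/
def DisK43 : Set BForm :=
  {φ | φ.OnlyDia0 ∧
    ∀ (T : Type) (R : T → T → Prop), Nonempty T → WeakOrd R → ModallyDiscrete R → UValid0 R φ}

def commAx1 : BForm :=
  BForm.imp (BForm.box1 (BForm.box0 (BForm.var 0))) (BForm.box0 (BForm.box1 (BForm.var 0)))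
def commAx2 : BForm :=
  BForm.imp (BForm.box0 (BForm.box1 (BForm.var 0))) (BForm.box1 (BForm.box0 (BForm.var 0)))
def commAx3 : BForm :=
  BForm.imp (BForm.dia0 (BForm.box1 (BForm.var 0))) (BForm.box1 (BForm.dia0 (BForm.var 0)))

/-- The commutator `[L0,L1]`: the smallest bimodal logic containing `L0`, `L1` (and
hence their fusion) together with the commutativity/confluence axioms. -/
def Commutator (L0 L1 : Set BForm) : Set BForm :=
  ⋂₀ {L : Set BForm | IsLogic L ∧ L0 ⊆ L ∧ L1 ⊆ L ∧
      commAx1 ∈ L ∧ commAx2 ∈ L ∧ commAx3 ∈ L}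

/-- The product logic `L0 × L1`: the logic of all products of a frame for `L0`
with a frame for `L1`. -/
def ProdLogic (L0 L1 : Set BForm) : Set BForm :=
  {φ | ∀ (A B : Type), Nonempty A → Nonempty B → ∀ (R : A → A → Prop) (S : B → B → Prop),
      (∀ ψ ∈ L0, UValid0 R ψ) → (∀ ψ ∈ L1, UValid1 S ψ) → ProdValid R S φ}

/-- The logic of a class of 2-frames. -/
def LogOf (C : Frame2 → Prop) : Set BForm := {φ | ∀ F, C F → F.Valid φ}

/-- Kripke completeness of a bimodal logic. -/
def KripkeComplete (L : Set BForm) : Prop := ∃ C : Frame2 → Prop, L = LogOf C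

/-- `L`-satisfiability: `φ` is satisfied in some model `M` with `M ⊨ L`. -/
def LSat (L : Set BForm) (φ : BForm) : Prop :=
  ∃ (W : Type) (_ : Nonempty W) (R0 R1 : W → W → Prop) (val : ℕ → W → Prop),
    (∀ ψ ∈ L, ∀ w, BSat R0 R1 val w ψ) ∧ ∃ w, BSat R0 R1 val w φ

/-! ## One-variable first-order temporal logic with counting (FOLTL≠) -/

/-- FOLTL≠-formulas: `φ ::= P(x) | ¬φ | φ∧ψ | ◇_F φ | ∃≠x φ`. -/
inductive TForm : Type
  | atom : ℕ → TForm
  | neg : TForm → TForm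
  | and : TForm → TForm → TForm
  | diaF : TForm → TForm
  | exNe : TForm → TForm

/-- Truth of an FOLTL≠-formula in a first-order temporal model based on the
timeline `⟨T,lt⟩` with domains `D` and interpretation `I`. -/
def TSat {T U : Type} (lt : T → T → Prop) (D : T → Set U) (I : ℕ → T → U → Prop) :
    T → U → TForm → Prop
  | t, a, .atom n => I n t a
  | t, a, .neg φ => ¬ TSat lt D I t a φ
  | t, a, .and φ ψ => TSat lt D I t a φ ∧ TSat lt D I t a ψ
  | t, a, .diaF φ => ∃ t', lt t t' ∧ a ∈ D t' ∧ TSat lt D I t' a φ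
  | t, a, .exNe φ => ∃ b, b ∈ D t ∧ b ≠ a ∧ TSat lt D I t b φ

/-- The standard translation `⋆` from FOLTL≠-formulas to bimodal formulas. -/
def TForm.star : TForm → BForm
  | .atom n => .var n
  | .neg φ => .neg (TForm.star φ)
  | .and φ ψ => .and (TForm.star φ) (TForm.star ψ)
  | .diaF φ => .dia0 (TForm.star φ)
  | .exNe φ => .dia1 (TForm.star φ)

/-- Satisfiability in constant domain models over the timeline `⟨T,lt⟩`. -/
def FOLTLConstSat {T : Type} (lt : T → T → Prop) (φ : TForm) : Prop :=
  ∃ (U : Type) (I : ℕ → T → U → Prop) (t : T) (a : U),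
    TSat lt (fun _ => (Set.univ : Set U)) I t a φ

/-- Satisfiability in decreasing domain models over the timeline `⟨T,lt⟩`. -/
def FOLTLDecSat {T : Type} (lt : T → T → Prop) (φ : TForm) : Prop :=
  ∃ (U : Type) (D : T → Set U), (∀ t, (D t).Nonempty) ∧
    (∀ t t', lt t t' → D t' ⊆ D t) ∧
    ∃ (I : ℕ → T → U → Prop) (t : T) (a : U), a ∈ D t ∧ TSat lt D I t a φ

/-- Satisfiability in expanding domain models over the timeline `⟨T,lt⟩`. -/
def FOLTLExpSat {T : Type} (lt : T → T → Prop) (φ : TForm) : Prop :=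
  ∃ (U : Type) (D : T → Set U), (∀ t, (D t).Nonempty) ∧
    (∀ t t', lt t t' → D t ⊆ D t') ∧
    ∃ (I : ℕ → T → U → Prop) (t : T) (a : U), a ∈ D t ∧ TSat lt D I t a φ

/-- Satisfiability in constant domain models over a class `C` of timelines. -/
def FOLTLConstSatC (C : Frame → Prop) (φ : TForm) : Prop :=
  ∃ F, C F ∧ FOLTLConstSat F.R φ

/-- Satisfiability in decreasing domain models over a class `C` of timelines. -/
def FOLTLDecSatC (C : Frame → Prop) (φ : TForm) : Prop :=
  ∃ F, C F ∧ FOLTLDecSat F.R φ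

/-- Satisfiability in expanding domain models over a class `C` of timelines. -/
def FOLTLExpSatC (C : Frame → Prop) (φ : TForm) : Prop :=
  ∃ F, C F ∧ FOLTLExpSat F.R φ

/-- The class of all linear orders. -/
def AllLin : Frame → Prop := fun F => IsLin F.R

/-- The class of all finite linear orders. -/
def AllFinLin : Frame → Prop := IsFinLinFrame

/-! ## Gödel numbering -/

/-- A fixed effective Gödel numbering of bimodal formulas. -/
def encodeB : BForm → ℕ
  | .var n => Nat.pair 0 n
  | .neg φ => Nat.pair 1 (encodeB φ)
  | .and φ ψ => Nat.pair 2 (Nat.pair (encodeB φ) (encodeB ψ))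
  | .dia0 φ => Nat.pair 3 (encodeB φ)
  | .dia1 φ => Nat.pair 4 (encodeB φ)

/-- A fixed effective Gödel numbering of FOLTL≠-formulas. -/
def encodeT : TForm → ℕ
  | .atom n => Nat.pair 0 n
  | .neg φ => Nat.pair 1 (encodeT φ)
  | .and φ ψ => Nat.pair 2 (Nat.pair (encodeT φ) (encodeT ψ))
  | .diaF φ => Nat.pair 3 (encodeT φ)
  | .exNe φ => Nat.pair 4 (encodeT φ)

/-- The set of codes of bimodal formulas with property `P`. -/
def BCodes (P : BForm → Prop) : ℕ → Prop := fun n => ∃ φ, encodeB φ = n ∧ P φ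

/-- The set of codes of FOLTL≠-formulas with property `P`. -/
def TCodes (P : TForm → Prop) : ℕ → Prop := fun n => ∃ φ, encodeT φ = n ∧ P φ

/-! ## The analytical hierarchy: Σ₁¹ -/

/-- `A ⊆ ℕ` is `Σ₁¹`: in normal form `n ∈ A ↔ ∃ f : ℕ → ℕ, ∀ m, R (n, f̄(m))`
for a computable predicate `R` of the number `n` and finite initial segments of `f`. -/
def Sigma11 (A : ℕ → Prop) : Prop :=
  ∃ R : ℕ × List ℕ → Prop, ComputablePred R ∧
    ∀ n, A n ↔ ∃ f : ℕ → ℕ, ∀ m, R (n, (List.range m).map f)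

/-- `Σ₁¹`-hardness with respect to computable many-one reducibility. -/
def Sigma11Hard (A : ℕ → Prop) : Prop := ∀ B : ℕ → Prop, Sigma11 B → ManyOneReducible B A

/-- `Σ₁¹`-completeness. -/
def Sigma11Complete (A : ℕ → Prop) : Prop := Sigma11 A ∧ Sigma11Hard A

/-! ## Counter (Minsky) machines -/

/-- Counter machine operations: `inl i` increments counter `i`, `inr (inl i)`
decrements counter `i`, `inr (inr i)` zero-tests counter `i`. -/
abbrev CMOp : Type := ℕ ⊕ ℕ ⊕ ℕ

def CMOp.counter : CMOp → ℕ
  | Sum.inl i => i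
  | Sum.inr (Sum.inl i) => i
  | Sum.inr (Sum.inr i) => i

/-- Description of a counter machine: number `N` of counters, number of states
(states are `0,…,states-1`), list of terminal states, and list of instructions
`(q, op, q')`. -/
abbrev CMDesc : Type := ℕ × ℕ × List ℕ × List (ℕ × CMOp × ℕ)

/-- Well-formedness of a counter machine description: `N > 1`, terminal states are
states, instructions are attached to non-terminal states and mention genuine
counters, and every non-terminal state has at least one instruction. -/
def CMWF (M : CMDesc) : Prop :=
  1 < M.1 ∧ (∀ q ∈ M.2.2.1, q < M.2.1) ∧
  (∀ t ∈ M.2.2.2, t.1 < M.2.1 ∧ t.1 ∉ M.2.2.1 ∧ t.2.2 < M.2.1 ∧ CMOp.counter t.2.1 < M.1) ∧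
  (∀ q, q < M.2.1 → q ∉ M.2.2.1 → ∃ t ∈ M.2.2.2, t.1 = q)

/-- A configuration: current state and contents of the counters. -/
abbrev CMConfig : Type := ℕ × (ℕ → ℕ)

/-- Reliable step of a counter machine. -/
def CMStep (M : CMDesc) (σ σ' : CMConfig) : Prop :=
  ∃ op q', (σ.1, op, q') ∈ M.2.2.2 ∧ σ'.1 = q' ∧
    match op with
    | Sum.inl i => σ'.2 i = σ.2 i + 1 ∧ ∀ j, j ≠ i → σ'.2 j = σ.2 j
    | Sum.inr (Sum.inl i) => 0 < σ.2 i ∧ σ'.2 i + 1 = σ.2 i ∧ ∀ j, j ≠ i → σ'.2 j = σ.2 j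
    | Sum.inr (Sum.inr i) => σ.2 i = 0 ∧ ∀ j, σ'.2 j = σ.2 j

/-- Lossy step of a counter machine. -/
def CMStepLossy (M : CMDesc) (σ σ' : CMConfig) : Prop :=
  ∃ c1 c2 : ℕ → ℕ, CMStep M (σ.1, c1) (σ'.1, c2) ∧ (∀ i, c1 i ≤ σ.2 i) ∧ (∀ i, σ'.2 i ≤ c2 i)

/-- The configuration `⟨q, 𝟎⟩` with all-0 counters. -/
def zeroConfig (q : ℕ) : CMConfig := (q, fun _ => 0)

/-- CM non-termination: the machine has an infinite run starting with `⟨q₀,𝟎⟩`. -/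
def CMNonTerm : CMDesc × ℕ → Prop := fun p =>
  CMWF p.1 ∧ ∃ ρ : ℕ → CMConfig, ρ 0 = zeroConfig p.2 ∧ ∀ n, CMStep p.1 (ρ n) (ρ (n+1))

/-- CM reachability: the machine has a run starting with `⟨q₀,𝟎⟩` reaching `q_r`. -/
def CMReach : CMDesc × ℕ × ℕ → Prop := fun p =>
  CMWF p.1 ∧ ∃ (B : ℕ) (ρ : ℕ → CMConfig), ρ 0 = zeroConfig p.2.1 ∧
    (∀ n, n < B → CMStep p.1 (ρ n) (ρ (n+1))) ∧ (ρ B).1 = p.2.2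

/-- CM recurrence: the machine has an infinite run starting with `⟨q₀,𝟎⟩`
visiting `q_r` infinitely often. -/
def CMRecur : CMDesc × ℕ × ℕ → Prop := fun p =>
  CMWF p.1 ∧ ∃ ρ : ℕ → CMConfig, ρ 0 = zeroConfig p.2.1 ∧
    (∀ n, CMStep p.1 (ρ n) (ρ (n+1))) ∧ ∀ n, ∃ m, n ≤ m ∧ (ρ m).1 = p.2.2

/-- LCM reachability: the machine has a lossy run starting with `⟨q₀,𝟎⟩`
reaching `q_r`. -/
def LCMReach : CMDesc × ℕ × ℕ → Prop := fun p =>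
  CMWF p.1 ∧ ∃ (B : ℕ) (ρ : ℕ → CMConfig), ρ 0 = zeroConfig p.2.1 ∧
    (∀ n, n < B → CMStepLossy p.1 (ρ n) (ρ (n+1))) ∧ (ρ B).1 = p.2.2

/-- LCM ω-reachability: for every `k`, the machine has a lossy run starting with
`⟨q₀,𝟎⟩` visiting `q_r` at least `k` times. -/
def LCMOmegaReach : CMDesc × ℕ × ℕ → Prop := fun p =>
  CMWF p.1 ∧ ∀ k : ℕ, ∃ (B : ℕ) (ρ : ℕ → CMConfig), ρ 0 = zeroConfig p.2.1 ∧
    (∀ n, n < B → CMStepLossy p.1 (ρ n) (ρ (n+1))) ∧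
    k ≤ ((Finset.range (B+1)).filter (fun n => (ρ n).1 = p.2.2)).card

/-! ## Particular formulas used in the statements -/

/-- `□₁⁺□₀⁺(◇₀⊤ → □₁◇₀⊤) ∧ φ` (Prop. 2.4 of the paper). -/
def diffDecForm (φ : BForm) : BForm :=
  BForm.and
    (BForm.boxP1 (BForm.boxP0
      (BForm.imp (BForm.dia0 BForm.top) (BForm.box1 (BForm.dia0 BForm.top))))) φ

/-- `D ∧ □₀^{≤n}□₁^{≤n}(◇₀D → D) ∧ φ^D`. -/
def decRelForm (d n : ℕ) (φ : BForm) : BForm :=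
  BForm.and (BForm.var d)
    (BForm.and
      (BForm.boxLe0 n (BForm.boxLe1 n
        (BForm.imp (BForm.dia0 (BForm.var d)) (BForm.var d))))
      (BForm.relativize d φ))

/-- `D ∧ □₀^{≤n}□₁^{≤n}(D → □₀D) ∧ φ^D`. -/
def expRelForm (d n : ℕ) (φ : BForm) : BForm :=
  BForm.and (BForm.var d)
    (BForm.and
      (BForm.boxLe0 n (BForm.boxLe1 n
        (BForm.imp (BForm.var d) (BForm.box0 (BForm.var d)))))
      (BForm.relativize d φ))

/-! ## The reduction formula -/

abbrev Ins : Type := ℕ × CMOp × ℕ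

def allF {β : Type} (L : List β) (F : β → BForm) : BForm := (L.map F).foldr BForm.and BForm.top
def exF {β : Type} (L : List β) (F : β → BForm) : BForm := BForm.neg (allF L (fun t => BForm.neg (F t)))
def diaP0 (φ : BForm) : BForm := BForm.neg (BForm.boxP0 (BForm.neg φ))
def diaP1 (φ : BForm) : BForm := BForm.neg (BForm.boxP1 (BForm.neg φ))
def vS (t : Ins) : BForm := BForm.var (2 * Encodable.encode t)
def vN (t : Ins) : BForm := BForm.var (2 * Encodable.encode t + 1)

def nextF (L : List Ins) (q : ℕ) : BForm :=
  exF L fun t => if t.1 = q then diaP1 (vN t) else BForm.bot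
def incF (L : List Ins) (i : ℕ) : BForm :=
  exF L fun t => if t.2.1 = Sum.inl i then diaP0 (vS t) else BForm.bot
def decF (L : List Ins) (i : ℕ) : BForm :=
  exF L fun t => if t.2.1 = Sum.inr (Sum.inl i) then diaP0 (vS t) else BForm.bot
def cntF (L : List Ins) (i : ℕ) : BForm := BForm.and (incF L i) (BForm.neg (decF L i))
def preF (L : List Ins) (t : Ins) : BForm :=
  if t.2.1 = Sum.inl (CMOp.counter t.2.1) then
    BForm.and (BForm.neg (incF L (CMOp.counter t.2.1))) (BForm.neg (decF L (CMOp.counter t.2.1)))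
  else if t.2.1 = Sum.inr (Sum.inl (CMOp.counter t.2.1)) then cntF L (CMOp.counter t.2.1)
  else BForm.boxP1 (BForm.neg (cntF L (CMOp.counter t.2.1)))

/-- Uniqueness within a column. -/
def uniqF (v : Ins → BForm) (t t' : Ins) : BForm :=
  BForm.imp (v t) (BForm.and (if t = t' then BForm.top else BForm.neg (v t'))
    (BForm.box1 (BForm.neg (v t'))))
def f4 (t t' : Ins) : BForm :=
  BForm.imp (vS t) (BForm.box0 (BForm.imp (BForm.and (BForm.neg (vS t)) (diaP1 (vS t')))
    (BForm.box0 (BForm.neg (vS t)))))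
def f5 (t t' : Ins) : BForm :=
  BForm.imp (vN t') (BForm.boxP1 (BForm.imp (BForm.and (BForm.dia0 (vN t))
    (BForm.neg (diaP0 (vS t)))) (vN t)))
def pairF (t t' : Ins) : BForm :=
  BForm.and (BForm.and (uniqF vS t t') (uniqF vN t t')) (BForm.and (f4 t t') (f5 t t'))
def oneF (L : List Ins) (t : Ins) : BForm :=
  BForm.and (BForm.imp (vS t) (BForm.and (BForm.dia0 (vN t)) (nextF L t.2.2)))
    (BForm.imp (vN t) (BForm.and (BForm.neg (diaP0 (vS t))) (preF L t)))
def globF (L : List Ins) : BForm :=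
  allF L fun t => BForm.and (oneF L t) (allF L fun t' => pairF t t')
def initF (L : List Ins) (q : ℕ) : BForm :=
  BForm.and (BForm.boxP1 (allF L fun t => BForm.neg (diaP0 (vS t)))) (nextF L q)
def stepF (L : List Ins) : BForm :=
  allF L fun t => BForm.imp (BForm.dia0 (vN t)) (BForm.dia0 (vS t))
def rootF (L : List Ins) (q : ℕ) : BForm :=
  BForm.and (BForm.dia0 (initF L q))
    (BForm.and (BForm.boxP1 (stepF L)) (BForm.boxP1 (BForm.box0 (globF L))))

/-! ## Semantics -/

section sem
variable {W : Type} {R0 R1 : W → W → Prop} {val : ℕ → W → Prop} {w : W}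

theorem sat_neg {φ} : BSat R0 R1 val w (BForm.neg φ) ↔ ¬ BSat R0 R1 val w φ := Iff.rfl
theorem sat_and {φ ψ} : BSat R0 R1 val w (BForm.and φ ψ) ↔
    BSat R0 R1 val w φ ∧ BSat R0 R1 val w ψ := Iff.rfl
theorem sat_dia0 {φ} : BSat R0 R1 val w (BForm.dia0 φ) ↔ ∃ v, R0 w v ∧ BSat R0 R1 val v φ := Iff.rfl
theorem sat_dia1 {φ} : BSat R0 R1 val w (BForm.dia1 φ) ↔ ∃ v, R1 w v ∧ BSat R0 R1 val v φ := Iff.rfl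
theorem sat_var {n} : BSat R0 R1 val w (BForm.var n) ↔ val n w := Iff.rfl
theorem sat_imp {φ ψ} : BSat R0 R1 val w (BForm.imp φ ψ) ↔
    (BSat R0 R1 val w φ → BSat R0 R1 val w ψ) := by
  simp only [BForm.imp, sat_neg, sat_and]; tauto
theorem sat_bot : BSat R0 R1 val w BForm.bot ↔ False := by
  simp only [BForm.bot, sat_neg, sat_and]; tauto
theorem sat_top : BSat R0 R1 val w BForm.top ↔ True := by
  simp only [BForm.top, sat_neg, sat_bot]; tauto
theorem sat_box0 {φ} : BSat R0 R1 val w (BForm.box0 φ) ↔ ∀ v, R0 w v → BSat R0 R1 val v φ := by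
  simp only [BForm.box0, sat_neg, sat_dia0]; push Not; rfl
theorem sat_box1 {φ} : BSat R0 R1 val w (BForm.box1 φ) ↔ ∀ v, R1 w v → BSat R0 R1 val v φ := by
  simp only [BForm.box1, sat_neg, sat_dia1]; push Not; rfl
theorem sat_allF {β : Type} {L : List β} {F : β → BForm} :
    BSat R0 R1 val w (allF L F) ↔ ∀ t ∈ L, BSat R0 R1 val w (F t) := by
  induction L with
  | nil => simp [allF, sat_top]
  | cons a l ih =>
    simp only [allF, List.map_cons, List.foldr_cons, sat_and] at ih ⊢
    rw [ih]; simp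
theorem sat_exF {β : Type} {L : List β} {F : β → BForm} :
    BSat R0 R1 val w (exF L F) ↔ ∃ t ∈ L, BSat R0 R1 val w (F t) := by
  simp only [exF, sat_neg, sat_allF]; push Not; rfl
theorem sat_ite {φ ψ} {p : Prop} {dp : Decidable p} : BSat R0 R1 val w (if p then φ else ψ) ↔
    ((p → BSat R0 R1 val w φ) ∧ (¬ p → BSat R0 R1 val w ψ)) := by
  split_ifs with h <;> simp [h]
theorem sat_ite_bot {φ} {p : Prop} {dp : Decidable p} : BSat R0 R1 val w (if p then φ else BForm.bot) ↔
    (p ∧ BSat R0 R1 val w φ) := by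
  split_ifs with h <;> simp [h, sat_bot]
theorem sat_boxP0 {φ} : BSat R0 R1 val w (BForm.boxP0 φ) ↔
    ∀ v, (w = v ∨ R0 w v) → BSat R0 R1 val v φ := by
  simp only [BForm.boxP0, sat_and, sat_box0]
  constructor
  · rintro ⟨h1, h2⟩ v (rfl | h); exacts [h1, h2 v h]
  · intro h; exact ⟨h w (Or.inl rfl), fun v hv => h v (Or.inr hv)⟩
theorem sat_diaP0 {φ} : BSat R0 R1 val w (diaP0 φ) ↔
    ∃ v, (w = v ∨ R0 w v) ∧ BSat R0 R1 val v φ := by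
  simp only [diaP0, sat_neg, sat_boxP0]; push Not; rfl
end sem

section tf
variable (T : TwoFrame) (val : ℕ → T.Worlds → Prop)

variable {T} in
/-- The world `(x, v)`. -/
def mkW (x : T.H) (v : T.V) (h : v ∈ T.D x) : T.Worlds := ⟨(x, v), h⟩

/-- truth at a pair -/
def E (x : T.H) (v : T.V) (φ : BForm) : Prop :=
  ∃ h : v ∈ T.D x, BSat T.Rh T.Rv val (mkW x v h) φ

variable {T val}
theorem E_of {x v φ} (h : v ∈ T.D x) : BSat T.Rh T.Rv val (mkW x v h) φ ↔ E T val x v φ :=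
  ⟨fun h' => ⟨h, h'⟩, fun h' => h'.2⟩

theorem E_dia0 {x v φ} (h : v ∈ T.D x) : BSat T.Rh T.Rv val (mkW x v h) (BForm.dia0 φ) ↔
    ∃ x', T.R x x' ∧ E T val x' v φ := by
  rw [sat_dia0]
  constructor
  · rintro ⟨⟨⟨x', v'⟩, h'⟩, ⟨h1, h2⟩, h3⟩
    simp only [mkW] at h1 h2; subst h2; exact ⟨x', h1, h', h3⟩
  · rintro ⟨x', h1, h', h3⟩; exact ⟨mkW x' v h', ⟨h1, rfl⟩, h3⟩

theorem E_box0 {x v φ} (h : v ∈ T.D x) : BSat T.Rh T.Rv val (mkW x v h) (BForm.box0 φ) ↔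
    ∀ x', T.R x x' → ∀ h' : v ∈ T.D x', BSat T.Rh T.Rv val (mkW x' v h') φ := by
  rw [sat_box0]
  constructor
  · intro H x' h1 h'; exact H _ ⟨h1, rfl⟩
  · rintro H ⟨⟨x', v'⟩, h'⟩ ⟨h1, h2⟩
    simp only [mkW] at h1 h2; subst h2; exact H x' h1 h'

theorem E_diaP0 {x v φ} (h : v ∈ T.D x) : BSat T.Rh T.Rv val (mkW x v h) (diaP0 φ) ↔
    ∃ x', (x = x' ∨ T.R x x') ∧ E T val x' v φ := by
  rw [sat_diaP0]
  constructor
  · rintro ⟨⟨⟨x', v'⟩, h'⟩, (h1 | ⟨h1, h2⟩), h3⟩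
    · have h1 := congrArg Subtype.val h1
      simp only [mkW, Prod.mk.injEq] at h1
      obtain ⟨rfl, rfl⟩ := h1; exact ⟨x, Or.inl rfl, h', h3⟩
    · simp only [mkW] at h1 h2; subst h2; exact ⟨x', Or.inr h1, h', h3⟩
  · rintro ⟨x', (rfl | h1), h', h3⟩
    · exact ⟨_, Or.inl rfl, h3⟩
    · exact ⟨mkW x' v h', Or.inr ⟨h1, rfl⟩, h3⟩

theorem E_box1 (hdiff : T.DiffFibers) {x v φ} (h : v ∈ T.D x) : BSat T.Rh T.Rv val (mkW x v h) (BForm.box1 φ) ↔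
    ∀ v', v ≠ v' → ∀ h' : v' ∈ T.D x, BSat T.Rh T.Rv val (mkW x v' h') φ := by
  rw [sat_box1]
  constructor
  · intro H v' h1 h'; exact H _ ⟨rfl, (hdiff x v h v' h').2 h1⟩
  · rintro H ⟨⟨x', v'⟩, h'⟩ ⟨h1, h2⟩
    simp only [mkW] at h1 h2; subst h1; exact H v' ((hdiff x v h v' h').1 h2) h'

theorem E_boxP1 (hdiff : T.DiffFibers) {x v φ} (h : v ∈ T.D x) : BSat T.Rh T.Rv val (mkW x v h) (BForm.boxP1 φ) ↔
    ∀ v', ∀ h' : v' ∈ T.D x, BSat T.Rh T.Rv val (mkW x v' h') φ := by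
  simp only [BForm.boxP1, sat_and, E_box1 hdiff]
  constructor
  · rintro ⟨h1, h2⟩ v' h'
    by_cases e : v = v'
    · subst e; exact h1
    · exact h2 v' e h'
  · intro H; exact ⟨H v h, fun v' _ h' => H v' h'⟩

theorem E_diaP1 (hdiff : T.DiffFibers) {x v φ} (h : v ∈ T.D x) : BSat T.Rh T.Rv val (mkW x v h) (diaP1 φ) ↔
    ∃ v', E T val x v' φ := by
  simp only [diaP1, sat_neg, E_boxP1 hdiff]; push Not; rfl

/-! ### Abstract description of the models of `rootF` -/
end tf

/-- Transition marks seen (weakly) from `x` in row `v`. -/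
def Mk {H V : Type} (R : H → H → Prop) (s : Ins → H → V → Prop) (t : Ins) (x : H) (v : V) : Prop :=
  ∃ z, (x = z ∨ R x z) ∧ s t z v

def MkI {H V : Type} (L : List Ins) (R : H → H → Prop) (s : Ins → H → V → Prop) (i : ℕ) (x : H) (v : V) : Prop :=
  ∃ t ∈ L, t.2.1 = Sum.inl i ∧ Mk R s t x v
def MkD {H V : Type} (L : List Ins) (R : H → H → Prop) (s : Ins → H → V → Prop) (i : ℕ) (x : H) (v : V) : Prop :=
  ∃ t ∈ L, t.2.1 = Sum.inr (Sum.inl i) ∧ Mk R s t x v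
def Cnt {H V : Type} (L : List Ins) (R : H → H → Prop) (s : Ins → H → V → Prop) (i : ℕ) (x : H) (v : V) : Prop :=
  MkI L R s i x v ∧ ¬ MkD L R s i x v

def PreA {H V : Type} (L : List Ins) (R : H → H → Prop) (s : Ins → H → V → Prop) (dom : H → Set V)
    (t : Ins) (x : H) (v : V) : Prop :=
  match t.2.1 with
  | Sum.inl i => ¬ MkI L R s i x v ∧ ¬ MkD L R s i x v
  | Sum.inr (Sum.inl i) => Cnt L R s i x v
  | Sum.inr (Sum.inr i) => ∀ v' ∈ dom x, ¬ Cnt L R s i x v'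

/-- The abstract description of a model of the formula, with `s`, `n` the interpretations of `vS`, `vN`. -/
structure Good {H V : Type} (L : List Ins) (q : ℕ) (R : H → H → Prop) (dom : H → Set V)
    (s n : Ins → H → V → Prop) (r : H) : Prop where
  init : ∃ x, R r x ∧ (∃ v, v ∈ dom x) ∧ (∀ t ∈ L, ∀ v ∈ dom x, ¬ Mk R s t x v) ∧ ∃ t ∈ L, t.1 = q ∧ ∃ v, n t x v
  step : ∀ t ∈ L, ∀ x v, R r x → n t x v → ∃ x', R r x' ∧ s t x' v
  uS : ∀ t ∈ L, ∀ t' ∈ L, ∀ x v v', R r x → s t x v → s t' x v' → t = t' ∧ v = v'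
  uN : ∀ t ∈ L, ∀ t' ∈ L, ∀ x v v', R r x → n t x v → n t' x v' → t = t' ∧ v = v'
  f4 : ∀ t ∈ L, ∀ t' ∈ L, ∀ x v, R r x → s t x v → ∀ z w, R x z → ¬ s t z v → s t' z w →
    ∀ z', R z z' → ¬ s t z' v
  f5 : ∀ t ∈ L, ∀ t' ∈ L, ∀ x v', R r x → n t' x v' → ∀ v x', R x x' → n t x' v → ¬ Mk R s t x v → n t x v
  sN : ∀ t ∈ L, ∀ x v, R r x → s t x v → ∃ x', R x x' ∧ n t x' v
  sX : ∀ t ∈ L, ∀ x v, R r x → s t x v → ∃ t' ∈ L, t'.1 = t.2.2 ∧ ∃ v', n t' x v'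
  nM : ∀ t ∈ L, ∀ x v, R r x → n t x v → ¬ Mk R s t x v
  nP : ∀ t ∈ L, ∀ x v, R r x → n t x v → PreA L R s dom t x v

section tf2
variable {T : TwoFrame} {val : ℕ → T.Worlds → Prop}

theorem sat_incF {L : List Ins} {i x v} (h : v ∈ T.D x) :
    BSat T.Rh T.Rv val (mkW x v h) (incF L i) ↔
      MkI L T.R (fun t x v => E T val x v (vS t)) i x v := by
  rw [incF, sat_exF]
  refine exists_congr fun t => and_congr_right fun _ => ?_
  rw [sat_ite_bot, E_diaP0]; rfl

theorem sat_decF {L : List Ins} {i x v} (h : v ∈ T.D x) :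
    BSat T.Rh T.Rv val (mkW x v h) (decF L i) ↔
      MkD L T.R (fun t x v => E T val x v (vS t)) i x v := by
  rw [decF, sat_exF]
  refine exists_congr fun t => and_congr_right fun _ => ?_
  rw [sat_ite_bot, E_diaP0]; rfl

theorem sat_cntF {L : List Ins} {i x v} (h : v ∈ T.D x) :
    BSat T.Rh T.Rv val (mkW x v h) (cntF L i) ↔
      Cnt L T.R (fun t x v => E T val x v (vS t)) i x v := by
  rw [cntF, sat_and, sat_neg, sat_incF, sat_decF]; rfl

theorem sat_nextF (hdiff : T.DiffFibers) {L : List Ins} {q x v} (h : v ∈ T.D x) :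
    BSat T.Rh T.Rv val (mkW x v h) (nextF L q) ↔ ∃ t ∈ L, t.1 = q ∧ ∃ v', E T val x v' (vN t) := by
  rw [nextF, sat_exF]
  refine exists_congr fun t => and_congr_right fun _ => ?_
  rw [sat_ite_bot, E_diaP1 hdiff]

theorem sat_preF (hdiff : T.DiffFibers) {L : List Ins} {t x v} (h : v ∈ T.D x) :
    BSat T.Rh T.Rv val (mkW x v h) (preF L t) ↔
      PreA L T.R (fun t x v => E T val x v (vS t)) T.D t x v := by
  obtain ⟨q, (i | i | i), q'⟩ := t
  · have : preF L (q, Sum.inl i, q') = BForm.and (BForm.neg (incF L i)) (BForm.neg (decF L i)) :=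
      if_pos rfl
    rw [this, sat_and, sat_neg, sat_neg, sat_incF, sat_decF]; rfl
  · have : preF L (q, Sum.inr (Sum.inl i), q') = cntF L i := by
      simp [preF, CMOp.counter]
    rw [this, sat_cntF]; rfl
  · have : preF L (q, Sum.inr (Sum.inr i), q') = BForm.boxP1 (BForm.neg (cntF L i)) := by
      simp [preF, CMOp.counter]
    rw [this, E_boxP1 hdiff]; simp only [sat_neg, sat_cntF]; rfl

theorem sat_rootF (hdec : T.Decreasing) (hdiff : T.DiffFibers) {L : List Ins} {q : ℕ} {r u} (h : u ∈ T.D r) :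
    BSat T.Rh T.Rv val (mkW r u h) (rootF L q) →
      Good L q T.R T.D (fun t x v => E T val x v (vS t)) (fun t x v => E T val x v (vN t)) r := by
  simp only [rootF, sat_and, E_dia0, E_boxP1 hdiff, E_box0, stepF, sat_allF, sat_imp]
  rintro ⟨⟨x0, hx0, hv0, hi⟩, hs, hg⟩
  have hg' : ∀ x v, T.R r x → ∀ h : v ∈ T.D x, BSat T.Rh T.Rv val (mkW x v h) (globF L) :=
    fun x v hx h => hg v ((hdec r x hx).1 h) x hx h
  simp only [globF, sat_allF, sat_and, oneF, pairF] at hg'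
  simp only [initF, sat_and, E_boxP1 hdiff, sat_allF, sat_neg, nextF, sat_exF, sat_ite_bot,
    E_diaP1 hdiff, E_diaP0] at hi
  constructor
  · exact ⟨x0, hx0, ⟨_, hv0⟩, fun t ht v hv => hi.1 v hv t ht, hi.2⟩
  · rintro t ht x v hx ⟨hv, hn⟩
    exact hs v ((hdec r x hx).1 hv) t ht ⟨x, hx, hv, hn⟩
  · rintro t ht t' ht' x v v' hx ⟨hv, hn⟩ ⟨hv', hn'⟩
    have := ((hg' x v hx hv t ht).2 t' ht').1.1
    simp only [uniqF, sat_imp, sat_and, E_box1 hdiff, sat_ite, sat_neg] at this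
    obtain ⟨h1, h2⟩ := this hn
    have e : v = v' := by
      by_contra e; exact h2 v' e hv' hn'
    subst e
    refine ⟨?_, rfl⟩
    by_contra e; exact h1.2 e hn'
  · rintro t ht t' ht' x v v' hx ⟨hv, hn⟩ ⟨hv', hn'⟩
    have := ((hg' x v hx hv t ht).2 t' ht').1.2
    simp only [uniqF, sat_imp, sat_and, E_box1 hdiff, sat_ite, sat_neg] at this
    obtain ⟨h1, h2⟩ := this hn
    have e : v = v' := by
      by_contra e; exact h2 v' e hv' hn'
    subst e
    refine ⟨?_, rfl⟩
    by_contra e; exact h1.2 e hn'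
  · rintro t ht t' ht' x v hx ⟨hv, hn⟩ z w hz hns hs' z' hz' ⟨hv', hn'⟩
    have := ((hg' x v hx hv t ht).2 t' ht').2.1
    simp only [HK.f4, sat_imp, sat_and, E_box0, E_diaP1 hdiff, sat_neg] at this
    have hvz := (hdec z z' hz').1 hv'
    exact this hn z hz hvz ⟨fun h => hns ⟨hvz, h⟩, w, hs'⟩ z' hz' hv' hn'
  · rintro t ht t' ht' x v' hx ⟨hv, hn⟩ v x' hx' hs' hm
    have := ((hg' x v' hx hv t ht).2 t' ht').2.2
    simp only [HK.f5, sat_imp, sat_and, E_dia0, E_boxP1 hdiff, E_diaP0, sat_neg] at this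
    have hv2 := (hdec x x' hx').1 hs'.1
    exact ⟨hv2, this hn v hv2 ⟨⟨x', hx', hs'⟩, hm⟩⟩
  · rintro t ht x v hx ⟨hv, hn⟩
    have := (hg' x v hx hv t ht).1.1
    simp only [sat_imp, sat_and, E_dia0] at this
    exact (this hn).1
  · rintro t ht x v hx ⟨hv, hn⟩
    have := (hg' x v hx hv t ht).1.1
    simp only [sat_imp, sat_and, nextF, sat_exF, sat_ite_bot, E_diaP1 hdiff] at this
    exact (this hn).2
  · rintro t ht x v hx ⟨hv, hn⟩
    have := (hg' x v hx hv t ht).1.2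
    simp only [sat_imp, sat_and, sat_neg, E_diaP0] at this
    exact (this hn).1
  · rintro t ht x v hx ⟨hv, hn⟩
    have := (hg' x v hx hv t ht).1.2
    simp only [sat_imp, sat_and, sat_preF hdiff] at this
    exact (this hn).2

theorem sat_rootF_of (hdec : T.Decreasing) (hdiff : T.DiffFibers) {L : List Ins} {q : ℕ} {r u} (h : u ∈ T.D r) (hall : ∀ x, u ∈ T.D x)
    (G : Good L q T.R T.D (fun t x v => E T val x v (vS t)) (fun t x v => E T val x v (vN t)) r) :
    BSat T.Rh T.Rv val (mkW r u h) (rootF L q) := by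
  simp only [rootF, sat_and, E_dia0, E_boxP1 hdiff, E_box0, stepF, sat_allF, sat_imp]
  refine ⟨?_, ?_, ?_⟩
  · obtain ⟨x, hx, _, hm, t, ht, e, hn⟩ := G.init
    refine ⟨x, hx, hall x, ?_⟩
    simp only [initF, sat_and, E_boxP1 hdiff, sat_allF, sat_neg, nextF, sat_exF, sat_ite_bot,
      E_diaP1 hdiff, E_diaP0]
    exact ⟨fun v hv t ht => hm t ht v hv, t, ht, e, hn⟩
  · rintro v hv t ht ⟨x, hx, hn⟩
    exact G.step t ht x v hx hn
  · intro v _ x hx hv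
    simp only [globF, sat_allF, sat_and, oneF, pairF, uniqF, HK.f4, HK.f5, sat_imp, sat_neg,
      E_box1 hdiff, E_box0, E_boxP1 hdiff, E_diaP0, E_diaP1 hdiff, E_dia0, sat_preF hdiff,
      sat_nextF hdiff, sat_ite, sat_top]
    simp only [E_of]
    intro t ht
    refine ⟨⟨fun hs => ⟨G.sN t ht x v hx hs, G.sX t ht x v hx hs⟩,
      fun hn => ⟨G.nM t ht x v hx hn, G.nP t ht x v hx hn⟩⟩, fun t' ht' => ⟨⟨?_, ?_⟩, ?_, ?_⟩⟩
    · exact fun hs => ⟨⟨fun _ => trivial, fun e hs' => e (G.uS t ht t' ht' x v v hx hs hs').1⟩,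
        fun v' e _ hs' => e (G.uS t ht t' ht' x v v' hx hs hs').2⟩
    · exact fun hs => ⟨⟨fun _ => trivial, fun e hs' => e (G.uN t ht t' ht' x v v hx hs hs').1⟩,
        fun v' e _ hs' => e (G.uN t ht t' ht' x v v' hx hs hs').2⟩
    · rintro hs z hz _ ⟨h1, w, h2⟩ z' hz' _
      exact G.f4 t ht t' ht' x v hx hs z w hz h1 h2 z' hz'
    · rintro hn v' _ ⟨⟨x', h1, h2⟩, h3⟩
      exact G.f5 t ht t' ht' x v hx hn v' x' h1 h2 h3
end tf2

/-! ## From models to runs -/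

section sound
variable {H V : Type} {L : List Ins} {q : ℕ} {R : H → H → Prop} {dom : H → Set V}
  {s n : Ins → H → V → Prop} {r : H}

theorem Good.next (G : Good L q R dom s n r) (hR : WeakOrd R)
    {x : H} {t : Ins} {v : V} (hx : R r x) (ht : t ∈ L) (hn : n t x v) :
    ∃ x', R r x' ∧ R x' x ∧ s t x' v ∧
      ∀ t' ∈ L, ∀ w, (Mk R s t' x' w ↔ Mk R s t' x w ∨ (t' = t ∧ w = v)) := by
  obtain ⟨x', hx', hs⟩ := G.step t ht x v hx hn
  have hM := G.nM t ht x v hx hn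
  have hxx : R x' x := by
    rcases hR.2 r x' x hx' hx with h | h | h
    · exact absurd ⟨x', Or.inl h.symm, hs⟩ hM
    · exact h
    · exact absurd ⟨x', Or.inr h, hs⟩ hM
  refine ⟨x', hx', hxx, hs, fun t' ht' w => ⟨?_, ?_⟩⟩
  · rintro ⟨z, hz, hsz⟩
    by_contra hcon
    push Not at hcon
    obtain ⟨hnm, hne⟩ := hcon
    rcases hz with rfl | hz
    · obtain ⟨e1, e2⟩ := G.uS t ht t' ht' x' v w hx' hs hsz
      exact hne e1.symm e2.symm
    have hrz : R r z := hR.1 _ _ _ hx' hz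
    have hnz : ¬ s t z v := fun h => by
      obtain ⟨e1, e2⟩ := G.uS t ht t' ht' z v w hrz h hsz
      exact hne e1.symm e2.symm
    have hafter := G.f4 t ht t' ht' x' v hx' hs z w hz hnz hsz
    obtain ⟨p, hzp, hp⟩ := G.sN t' ht' z w hrz hsz
    have hrp : R r p := hR.1 _ _ _ hrz hzp
    rcases hR.2 r p x hrp hx with h | h | h
    · subst h
      obtain ⟨e1, e2⟩ := G.uN t ht t' ht' p v w hrp hn hp
      exact hne e1.symm e2.symm
    · have hmk : ¬ Mk R s t p v := by
        rintro ⟨y, rfl | hy, hsy⟩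
        · exact hafter _ hzp hsy
        · exact hafter _ (hR.1 _ _ _ hzp hy) hsy
      have := G.f5 t ht t' ht' p w hrp hp v x h hn hmk
      obtain ⟨e1, e2⟩ := G.uN t ht t' ht' p v w hrp this hp
      exact hne e1.symm e2.symm
    · have := G.f5 t' ht' t ht x v hx hn w p h hp hnm
      obtain ⟨e1, e2⟩ := G.uN t ht t' ht' x v w hx hn this
      exact hne e1.symm e2.symm
  · rintro (⟨z, rfl | hz, hsz⟩ | ⟨rfl, rfl⟩)
    · exact ⟨_, Or.inr hxx, hsz⟩
    · exact ⟨z, Or.inr (hR.1 _ _ _ hxx hz), hsz⟩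
    · exact ⟨x', Or.inl rfl, hs⟩

/-- The state of the run extraction. -/
structure RS (L : List Ins) (R : H → H → Prop) (s n : Ins → H → V → Prop) (r : H) where
  x : H
  t : Ins
  v : V
  hx : R r x
  ht : t ∈ L
  hn : n t x v
  fin : ∀ i, {w | Cnt L R s i x w}.Finite

noncomputable def RS.conf (a : RS L R s n r) : CMConfig :=
  (a.t.1, fun i => {w | Cnt L R s i a.x w}.ncard)

theorem RS.next (G : Good L q R dom s n r) (hR : WeakOrd R)
    (hdom : ∀ t x v, s t x v → v ∈ dom x) (hdec : ∀ x y, R x y → dom y ⊆ dom x)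
    (M : CMDesc) (hM : M.2.2.2 = L) (a : RS L R s n r) :
    ∃ b : RS L R s n r, CMStep M a.conf b.conf := by
  obtain ⟨x, t, v, hx, ht, hn, fin⟩ := a
  obtain ⟨x', hx', hxx, hs, hmk⟩ := G.next hR hx ht hn
  obtain ⟨t2, ht2, e2, v2, hn2⟩ := G.sX t ht x' v hx' hs
  have hI : ∀ j w, MkI L R s j x' w ↔ MkI L R s j x w ∨ (t.2.1 = Sum.inl j ∧ w = v) := by
    intro j w
    constructor
    · rintro ⟨t', ht', e, h⟩
      rcases (hmk t' ht' w).1 h with h | ⟨rfl, rfl⟩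
      · exact Or.inl ⟨t', ht', e, h⟩
      · exact Or.inr ⟨e, rfl⟩
    · rintro (⟨t', ht', e, h⟩ | ⟨e, rfl⟩)
      · exact ⟨t', ht', e, (hmk t' ht' w).2 (Or.inl h)⟩
      · exact ⟨t, ht, e, (hmk t ht w).2 (Or.inr ⟨rfl, rfl⟩)⟩
  have hD : ∀ j w, MkD L R s j x' w ↔ MkD L R s j x w ∨ (t.2.1 = Sum.inr (Sum.inl j) ∧ w = v) := by
    intro j w
    constructor
    · rintro ⟨t', ht', e, h⟩
      rcases (hmk t' ht' w).1 h with h | ⟨rfl, rfl⟩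
      · exact Or.inl ⟨t', ht', e, h⟩
      · exact Or.inr ⟨e, rfl⟩
    · rintro (⟨t', ht', e, h⟩ | ⟨e, rfl⟩)
      · exact ⟨t', ht', e, (hmk t' ht' w).2 (Or.inl h)⟩
      · exact ⟨t, ht, e, (hmk t ht w).2 (Or.inr ⟨rfl, rfl⟩)⟩
  have hP := G.nP t ht x v hx hn
  obtain ⟨q1, op, q2⟩ := t
  rcases op with i | i | i
  · simp only [PreA] at hP
    simp only [reduceCtorEq, false_and, or_false, Sum.inl.injEq] at hI hD
    have h1 : {w | Cnt L R s i x' w} = insert v {w | Cnt L R s i x w} := by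
      ext w
      simp only [Set.mem_setOf_eq, Set.mem_insert_iff, Cnt, hI, hD, true_and]
      constructor
      · tauto
      · rintro (rfl | h)
        · exact ⟨Or.inr rfl, hP.2⟩
        · tauto
    have h2 : ∀ j, j ≠ i → {w | Cnt L R s j x' w} = {w | Cnt L R s j x w} := by
      intro j hj
      ext w
      simp only [Set.mem_setOf_eq, Cnt, hI, hD, Ne.symm hj, false_and, or_false]
    refine ⟨⟨x', t2, v2, hx', ht2, hn2, fun j => ?_⟩, Sum.inl i, q2, hM ▸ ht, e2, ?_, fun j hj => ?_⟩
    · by_cases hj : j = i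
      · subst hj; rw [h1]; exact (fin j).insert v
      · rw [h2 j hj]; exact fin j
    · simp only [RS.conf]
      rw [h1]
      exact Set.ncard_insert_of_notMem (fun h => hP.1 h.1) (fin i)
    · simp only [RS.conf]
      rw [h2 j hj]
  · simp only [PreA] at hP
    simp only [reduceCtorEq, false_and, or_false, Sum.inl.injEq, Sum.inr.injEq] at hI hD
    have h1 : {w | Cnt L R s i x' w} = {w | Cnt L R s i x w} \ {v} := by
      ext w
      simp only [Set.mem_setOf_eq, Set.mem_diff, Set.mem_singleton_iff, Cnt, hI, hD, true_and]
      tauto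
    have h2 : ∀ j, j ≠ i → {w | Cnt L R s j x' w} = {w | Cnt L R s j x w} := by
      intro j hj
      ext w
      simp only [Set.mem_setOf_eq, Cnt, hI, hD, Ne.symm hj, false_and, or_false]
    refine ⟨⟨x', t2, v2, hx', ht2, hn2, fun j => ?_⟩, Sum.inr (Sum.inl i), q2, hM ▸ ht, e2, ?_, ?_, fun j hj => ?_⟩
    · by_cases hj : j = i
      · subst hj; rw [h1]; exact (fin j).diff
      · rw [h2 j hj]; exact fin j
    · simp only [RS.conf]
      exact (Set.ncard_pos (fin i)).2 ⟨v, hP⟩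
    · simp only [RS.conf]
      rw [h1]
      exact Set.ncard_diff_singleton_add_one hP (fin i)
    · simp only [RS.conf]
      rw [h2 j hj]
  · simp only [PreA] at hP
    simp only [reduceCtorEq, false_and, or_false, Sum.inl.injEq, Sum.inr.injEq] at hI hD
    have h2 : ∀ j, {w | Cnt L R s j x' w} = {w | Cnt L R s j x w} := by
      intro j
      ext w
      simp only [Set.mem_setOf_eq, Cnt, hI, hD]
    refine ⟨⟨x', t2, v2, hx', ht2, hn2, fun j => ?_⟩, Sum.inr (Sum.inr i), q2, hM ▸ ht, e2, ?_, fun j => ?_⟩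
    · rw [h2 j]; exact fin j
    · simp only [RS.conf]
      have : {w | Cnt L R s i x w} = ∅ := by
        ext w
        simp only [Set.mem_setOf_eq, Set.mem_empty_iff_false, iff_false]
        intro h
        obtain ⟨t', _, _, z, hz, hsz⟩ := h.1
        refine hP w ?_ h
        rcases hz with rfl | hz
        · exact hdom _ _ _ hsz
        · exact hdec _ _ hz (hdom _ _ _ hsz)
      rw [this, Set.ncard_empty]
    · simp only [RS.conf]
      rw [h2 j]

theorem Good.run (G : Good L q R dom s n r) (hR : WeakOrd R)
    (hdom : ∀ t x v, s t x v → v ∈ dom x) (hdec : ∀ x y, R x y → dom y ⊆ dom x)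
    (M : CMDesc) (hM : M.2.2.2 = L) :
    ∃ ρ : ℕ → CMConfig, ρ 0 = zeroConfig q ∧ ∀ n, CMStep M (ρ n) (ρ (n+1)) := by
  obtain ⟨x, hx, _, hmk, t, ht, e, v, hn⟩ := G.init
  have hempty : ∀ i, {w | Cnt L R s i x w} = ∅ := by
    intro i
    ext w
    simp only [Set.mem_setOf_eq, Set.mem_empty_iff_false, iff_false]
    intro h
    obtain ⟨t', ht', _, z, hz, hsz⟩ := h.1
    refine hmk t' ht' w ?_ ⟨z, hz, hsz⟩
    rcases hz with rfl | hz
    · exact hdom _ _ _ hsz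
    · exact hdec _ _ hz (hdom _ _ _ hsz)
  choose f hf using RS.next G hR hdom hdec M hM
  let a0 : RS L R s n r := ⟨x, t, v, hx, ht, hn, fun i => by rw [hempty i]; exact Set.finite_empty⟩
  refine ⟨fun k => (f^[k] a0).conf, ?_, fun k => ?_⟩
  · simp only [Function.iterate_zero, id, RS.conf, zeroConfig, a0, e]
    refine Prod.ext rfl (funext fun i => ?_)
    show Set.ncard {w | Cnt L R s i x w} = 0
    rw [hempty i, Set.ncard_empty]
  · simp only [Function.iterate_succ_apply']
    exact hf _
end sound

theorem run_of_sat {C : Frame → Prop} (hC : ∀ F, C F → WeakOrd F.R) {M : CMDesc} {q : ℕ}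
    (h : DecDiffSat C (rootF M.2.2.2 q)) :
    ∃ ρ : ℕ → CMConfig, ρ 0 = zeroConfig q ∧ ∀ n, CMStep M (ρ n) (ρ (n+1)) := by
  obtain ⟨T, hT, hdec, hdiff, val, ⟨⟨r, u⟩, hu⟩, hw⟩ := h
  have G := sat_rootF hdec hdiff hu hw
  exact G.run (hC _ hT) (fun t x v h => h.1) (fun x y h => (hdec x y h).1) M rfl

/-! ## From runs to models -/

/-- The row used by a transition. -/
noncomputable def pickRow (op : CMOp) (D : ℕ → Finset ℕ) (n : ℕ) : ℕ :=
  open Classical in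
  match op with
  | Sum.inl _ => n
  | Sum.inr (Sum.inl i) => if h : (D i).Nonempty then h.choose else n
  | Sum.inr (Sum.inr _) => n

/-- The update of the sets of rows representing the counters. -/
noncomputable def updRows (op : CMOp) (D : ℕ → Finset ℕ) (n : ℕ) : ℕ → Finset ℕ :=
  match op with
  | Sum.inl i => fun j => if j = i then insert n (D j) else D j
  | Sum.inr (Sum.inl i) => fun j => if j = i then (D j).erase (pickRow op D n) else D j
  | Sum.inr (Sum.inr _) => D

noncomputable def rowSets (op : ℕ → CMOp) : ℕ → ℕ → Finset ℕ
  | 0 => fun _ => ∅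
  | n+1 => updRows (op n) (rowSets op n) n

noncomputable def rows (op : ℕ → CMOp) (n : ℕ) : ℕ := pickRow (op n) (rowSets op n) n

section rows
variable {op : ℕ → CMOp}

theorem rows_inc {n i} (h : op n = Sum.inl i) : rows op n = n := by
  simp [rows, h, pickRow]
theorem rows_test {n i} (h : op n = Sum.inr (Sum.inr i)) : rows op n = n := by
  simp [rows, h, pickRow]
theorem rows_dec {n i} (h : op n = Sum.inr (Sum.inl i)) (hne : (rowSets op n i).Nonempty) :
    rows op n ∈ rowSets op n i := by
  simp only [rows, h, pickRow, dif_pos hne]; exact hne.choose_spec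

theorem mem_rowSets_succ {n j v} : v ∈ rowSets op (n+1) j ↔
    (v ∈ rowSets op n j ∧ ¬ (op n = Sum.inr (Sum.inl j) ∧ v = rows op n)) ∨
      (op n = Sum.inl j ∧ v = n) := by
  simp only [rowSets]
  rcases h : op n with i | i | i
  · simp only [updRows]
    by_cases hj : j = i
    · subst hj; simp; tauto
    · simp [hj, Ne.symm hj]
  · simp only [updRows]
    by_cases hj : j = i
    · subst hj; simp [rows, h]; tauto
    · simp [hj, Ne.symm hj]
  · simp [updRows]

theorem rowSets_lt {n j v} (h : v ∈ rowSets op n j) : v < n := by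
  induction n with
  | zero => simp [rowSets] at h
  | succ n ih =>
    rcases mem_rowSets_succ.1 h with h | h
    · exact (ih h.1).trans (Nat.lt_succ_self n)
    · omega

theorem rows_le (n : ℕ) : rows op n ≤ n := by
  rcases h : op n with i | i | i
  · rw [rows_inc h]
  · by_cases hne : (rowSets op n i).Nonempty
    · exact (rowSets_lt (rows_dec h hne)).le
    · simp [rows, h, pickRow, hne]
  · rw [rows_test h]

theorem mem_rowSets {n j v} : v ∈ rowSets op n j ↔
    (∃ k < n, op k = Sum.inl j ∧ v = rows op k) ∧
      ¬ ∃ k < n, op k = Sum.inr (Sum.inl j) ∧ v = rows op k := by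
  induction n with
  | zero => simp [rowSets]
  | succ n ih =>
    rw [mem_rowSets_succ, ih]
    constructor
    · rintro (⟨⟨⟨k, hk, h1, h2⟩, h3⟩, h4⟩ | ⟨h1, rfl⟩)
      · refine ⟨⟨k, by omega, h1, h2⟩, ?_⟩
        rintro ⟨k', hk', h5, h6⟩
        rcases Nat.lt_succ_iff_lt_or_eq.1 hk' with h | rfl
        · exact h3 ⟨k', h, h5, h6⟩
        · exact h4 ⟨h5, h6⟩
      · refine ⟨⟨v, by omega, h1, (rows_inc h1).symm⟩, ?_⟩
        rintro ⟨k', hk', h5, h6⟩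
        have := rows_le (op := op) k'
        have : k' = v := by omega
        subst this; rw [h1] at h5; cases h5
    · rintro ⟨⟨k, hk, h1, h2⟩, h3⟩
      rcases Nat.lt_succ_iff_lt_or_eq.1 hk with h | rfl
      · refine Or.inl ⟨⟨⟨k, h, h1, h2⟩, ?_⟩, ?_⟩
        · rintro ⟨k', hk', h5, h6⟩; exact h3 ⟨k', by omega, h5, h6⟩
        · rintro ⟨h5, h6⟩; exact h3 ⟨n, by omega, h5, h6⟩
      · exact Or.inr ⟨h1, by rw [h2, rows_inc h1]⟩
end rows

/-- The effect of an operation. -/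
def Eff (op : CMOp) (c c' : ℕ → ℕ) : Prop :=
  match op with
  | Sum.inl i => c' i = c i + 1 ∧ ∀ j, j ≠ i → c' j = c j
  | Sum.inr (Sum.inl i) => 0 < c i ∧ c' i + 1 = c i ∧ ∀ j, j ≠ i → c' j = c j
  | Sum.inr (Sum.inr i) => c i = 0 ∧ ∀ j, c' j = c j

theorem card_rowSets {op : ℕ → CMOp} {c : ℕ → ℕ → ℕ} (h0 : ∀ i, c 0 i = 0)
    (hs : ∀ n, Eff (op n) (c n) (c (n+1))) (n i : ℕ) : (rowSets op n i).card = c n i := by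
  induction n generalizing i with
  | zero => simp [rowSets, h0]
  | succ n ih =>
    have hn := hs n
    rcases h : op n with j | j | j
    · simp only [h, Eff] at hn
      by_cases hj : i = j
      · subst hj
        rw [hn.1, ← ih, rowSets, h]
        simp only [updRows, if_true]
        exact Finset.card_insert_of_notMem fun hh => lt_irrefl _ (rowSets_lt hh)
      · rw [hn.2 i hj, ← ih, rowSets, h]
        simp only [updRows, if_neg hj]
    · simp only [h, Eff] at hn
      by_cases hj : i = j
      · subst hj
        have hne : (rowSets op n i).Nonempty := by
          rw [← Finset.card_pos, ih]; exact hn.1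
        have hm := rows_dec h hne
        have : (rowSets op (n+1) i) = (rowSets op n i).erase (rows op n) := by
          rw [rowSets, rows, h]; simp [updRows]
        rw [this]
        have := Finset.card_erase_add_one hm
        rw [ih] at this
        omega
      · rw [hn.2.2 i hj, ← ih, rowSets, h]
        simp only [updRows, if_neg hj]
    · simp only [h, Eff] at hn
      rw [hn.2, ← ih, rowSets, h]
      simp only [updRows]

theorem good_of_run {H : Type} {R : H → H → Prop} {x : ℕ → H} {xω : H}
    (hinj : Function.Injective x)
    (hx : ∀ n m, n ≠ m → (R (x n) (x m) ↔ m < n)) (hω : ∀ n, R xω (x n))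
    {L : List Ins} {q : ℕ} (t : ℕ → Ins) (c : ℕ → ℕ → ℕ)
    (htL : ∀ n, t n ∈ L) (hq : (t 0).1 = q) (hnext : ∀ n, (t (n+1)).1 = (t n).2.2)
    (h0 : ∀ i, c 0 i = 0) (hs : ∀ n, Eff (t n).2.1 (c n) (c (n+1))) :
    Good L q R (fun _ => (Set.univ : Set ℕ))
      (fun t' p v => ∃ n, p = x (n+1) ∧ v = rows (fun n => (t n).2.1) n ∧ t' = t n)
      (fun t' p v => ∃ n, p = x n ∧ v = rows (fun n => (t n).2.1) n ∧ t' = t n) xω := by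
  set op : ℕ → CMOp := fun n => (t n).2.1 with hop
  set s : Ins → H → ℕ → Prop := fun t' p v => ∃ n, p = x (n+1) ∧ v = rows op n ∧ t' = t n with hsdef
  have card := card_rowSets (op := op) h0 hs
  have hRle : ∀ n m, R (x n) (x m) → m ≤ n := by
    intro n m h
    by_cases e : n = m
    · omega
    · exact ((hx n m e).1 h).le
  have hRlt : ∀ n m, m < n → R (x n) (x m) := fun n m h => (hx n m (by omega)).2 h
  have hMk : ∀ t' m w, Mk R s t' (x m) w ↔ ∃ k < m, t' = t k ∧ w = rows op k := by
    intro t' m w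
    constructor
    · rintro ⟨z, hz, n, rfl, h2, h3⟩
      refine ⟨n, ?_, h3, h2⟩
      rcases hz with hz | hz
      · have := hinj hz; omega
      · have := hRle _ _ hz; omega
    · rintro ⟨k, hk, h1, h2⟩
      refine ⟨x (k+1), ?_, k, rfl, h2, h1⟩
      by_cases e : m = k+1
      · left; rw [e]
      · right; exact hRlt _ _ (by omega)
  have hI : ∀ i m w, MkI L R s i (x m) w ↔ ∃ k < m, op k = Sum.inl i ∧ w = rows op k := by
    intro i m w
    simp only [MkI, hMk]
    constructor
    · rintro ⟨t', _, e, k, hk, rfl, h⟩; exact ⟨k, hk, e, h⟩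
    · rintro ⟨k, hk, e, h⟩; exact ⟨t k, htL k, e, k, hk, rfl, h⟩
  have hD : ∀ i m w, MkD L R s i (x m) w ↔ ∃ k < m, op k = Sum.inr (Sum.inl i) ∧ w = rows op k := by
    intro i m w
    simp only [MkD, hMk]
    constructor
    · rintro ⟨t', _, e, k, hk, rfl, h⟩; exact ⟨k, hk, e, h⟩
    · rintro ⟨k, hk, e, h⟩; exact ⟨t k, htL k, e, k, hk, rfl, h⟩
  have hC : ∀ i m w, Cnt L R s i (x m) w ↔ w ∈ rowSets op m i := by
    intro i m w
    rw [Cnt, hI, hD, mem_rowSets]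
  have hdecmem : ∀ m i, op m = Sum.inr (Sum.inl i) → rows op m ∈ rowSets op m i := by
    intro m i e
    refine rows_dec e ?_
    rw [← Finset.card_pos, card]
    have := hs m
    simp only [hop] at e
    simp only [e, Eff] at this
    exact this.1
  have huniq : ∀ k m, k < m → t k = t m → rows op k ≠ rows op m := by
    intro k m hkm e e'
    have eo : op k = op m := by simp only [hop, e]
    rcases h : op m with i | i | i
    · rw [rows_inc h, rows_inc (eo.trans h)] at e'; omega
    · exact (mem_rowSets.1 (hdecmem m i h)).2 ⟨k, hkm, eo.trans h, e'.symm⟩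
    · rw [rows_test h, rows_test (eo.trans h)] at e'; omega
  have huniq' : ∀ k m, t k = t m → rows op k = rows op m → k = m := by
    intro k m e e'
    rcases lt_trichotomy k m with h | h | h
    · exact absurd e' (huniq k m h e)
    · exact h
    · exact absurd e'.symm (huniq m k h e.symm)
  constructor
  · refine ⟨x 0, hω 0, ⟨0, trivial⟩, ?_, t 0, htL 0, hq, _, 0, rfl, rfl, rfl⟩
    intro t' _ v _ h
    obtain ⟨k, hk, _⟩ := (hMk _ _ _).1 h
    omega
  · rintro _ _ _ _ _ ⟨n, rfl, rfl, rfl⟩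
    exact ⟨x (n+1), hω _, n, rfl, rfl, rfl⟩
  · rintro _ _ _ _ _ _ _ _ ⟨n, rfl, rfl, rfl⟩ ⟨m, e, rfl, rfl⟩
    have := hinj e
    have : n = m := by omega
    subst this; exact ⟨rfl, rfl⟩
  · rintro _ _ _ _ _ _ _ _ ⟨n, rfl, rfl, rfl⟩ ⟨m, e, rfl, rfl⟩
    have := hinj e
    subst this; exact ⟨rfl, rfl⟩
  · rintro _ _ _ _ _ _ _ ⟨n, rfl, rfl, rfl⟩ _ _ hz hns ⟨m, rfl, rfl, rfl⟩ _ hz' ⟨k, rfl, e1, e2⟩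
    have := huniq' _ _ e2 e1
    subst this
    have h1 := hRle _ _ hz
    have h2 := hRle _ _ hz'
    have : n = m := by omega
    subst this
    exact hns ⟨n, rfl, rfl, rfl⟩
  · rintro _ _ _ _ _ _ _ ⟨k, rfl, rfl, rfl⟩ _ _ hz ⟨m, rfl, rfl, rfl⟩ hm
    have h1 := hRle _ _ hz
    rw [hMk] at hm
    have : m = k := by
      by_contra e
      exact hm ⟨m, by omega, rfl, rfl⟩
    subst this
    exact ⟨m, rfl, rfl, rfl⟩
  · rintro _ _ _ _ _ ⟨n, rfl, rfl, rfl⟩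
    exact ⟨x n, hRlt _ _ (by omega), n, rfl, rfl, rfl⟩
  · rintro _ _ _ _ _ ⟨n, rfl, rfl, rfl⟩
    exact ⟨t (n+1), htL _, hnext n, _, n+1, rfl, rfl, rfl⟩
  · rintro _ _ _ _ _ ⟨n, rfl, rfl, rfl⟩ h
    obtain ⟨k, hk, e1, e2⟩ := (hMk _ _ _).1 h
    have := huniq' _ _ e1 e2
    omega
  · rintro _ _ _ _ _ ⟨n, rfl, rfl, rfl⟩
    rcases h : op n with i | i | i
    · have h' : (t n).2.1 = Sum.inl i := h
      simp only [PreA, h', hI, hD]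
      rw [rows_inc h]
      constructor
      · rintro ⟨k, hk, _, e⟩; have := rows_le (op := op) k; omega
      · rintro ⟨k, hk, _, e⟩; have := rows_le (op := op) k; omega
    · have h' : (t n).2.1 = Sum.inr (Sum.inl i) := h
      simp only [PreA, h', hC]
      exact hdecmem n i h
    · have h' : (t n).2.1 = Sum.inr (Sum.inr i) := h
      simp only [PreA, h', hC]
      have := hs n
      simp only [h', Eff] at this
      have hc := card n i
      rw [this.1, Finset.card_eq_zero] at hc
      intro v _
      rw [hc]; simp

theorem sat_of_run {C : Frame → Prop} (hchain : ∃ F, C F ∧ HasOmegaPlusOneChain F) {M : CMDesc} {q : ℕ}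
    (h : ∃ ρ : ℕ → CMConfig, ρ 0 = zeroConfig q ∧ ∀ n, CMStep M (ρ n) (ρ (n+1))) :
    DecDiffSat C (rootF M.2.2.2 q) := by
  obtain ⟨F, hF, x, xω, hinj, -, hx, hω, -⟩ := hchain
  obtain ⟨ρ, hρ0, hρ⟩ := h
  have hρ' : ∀ n, ∃ t : Ins, t ∈ M.2.2.2 ∧ t.1 = (ρ n).1 ∧ t.2.2 = (ρ (n+1)).1 ∧
      Eff t.2.1 (ρ n).2 (ρ (n+1)).2 := by
    intro n
    obtain ⟨op, q', h1, h2, h3⟩ := hρ n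
    exact ⟨_, h1, rfl, h2.symm, h3⟩
  choose t htL ht1 ht2 hE using hρ'
  let T : TwoFrame := ⟨F.W, F.R, F.ne, ℕ, fun _ => Set.univ, fun _ a b => a ≠ b,
    fun _ => ⟨0, trivial⟩⟩
  have hdec : T.Decreasing := fun x y _ => ⟨fun _ h => h, fun _ _ _ _ => Iff.rfl⟩
  have hdiff : T.DiffFibers := fun x a _ b _ => Iff.rfl
  let y := rows (fun n => (t n).2.1)
  let val : ℕ → T.Worlds → Prop := fun k w =>
    (∃ n, k = 2 * Encodable.encode (t n) ∧ w.1.1 = x (n+1) ∧ w.1.2 = y n) ∨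
    (∃ n, k = 2 * Encodable.encode (t n) + 1 ∧ w.1.1 = x n ∧ w.1.2 = y n)
  have G := good_of_run (L := M.2.2.2) (q := q) hinj hx hω t (fun n => (ρ n).2) htL
    (by rw [ht1, hρ0]; rfl) (fun n => by rw [ht1, ht2]) (fun i => by simp only [hρ0]; rfl) hE
  refine ⟨T, hF, hdec, hdiff, val, mkW xω 0 trivial, ?_⟩
  refine sat_rootF_of hdec hdiff trivial (fun _ => trivial) ?_
  convert G using 4 with t' p v t' p v
  · constructor
    · rintro ⟨_, ⟨n, h1, h2, h3⟩ | ⟨n, h1, h2, h3⟩⟩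
      · exact ⟨n, h2, h3, Encodable.encode_injective (by omega)⟩
      · omega
    · rintro ⟨n, h1, h2, rfl⟩
      exact ⟨trivial, Or.inl ⟨n, rfl, h1, h2⟩⟩
  · constructor
    · rintro ⟨_, ⟨n, h1, h2, h3⟩ | ⟨n, h1, h2, h3⟩⟩
      · omega
      · exact ⟨n, h2, h3, Encodable.encode_injective (by omega)⟩
    · rintro ⟨n, h1, h2, rfl⟩
      exact ⟨trivial, Or.inr ⟨n, rfl, h1, h2⟩⟩

/-! ## Computability of the reduction -/

/-- A formula-valued function is primitive recursive (via codes). -/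
def PR {α : Type} [Primcodable α] (F : α → BForm) : Prop := Primrec fun a => encodeB (F a)

section PR
variable {α β : Type} [Primcodable α] [Primcodable β]

theorem PR.var {f : α → ℕ} (hf : Primrec f) : PR fun a => BForm.var (f a) :=
  Primrec₂.natPair.comp (Primrec.const 0) hf
theorem PR.neg {F : α → BForm} (hF : PR F) : PR fun a => BForm.neg (F a) :=
  Primrec₂.natPair.comp (Primrec.const 1) hF
theorem PR.and {F G : α → BForm} (hF : PR F) (hG : PR G) : PR fun a => BForm.and (F a) (G a) :=
  Primrec₂.natPair.comp (Primrec.const 2) (Primrec₂.natPair.comp hF hG)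
theorem PR.dia0 {F : α → BForm} (hF : PR F) : PR fun a => BForm.dia0 (F a) :=
  Primrec₂.natPair.comp (Primrec.const 3) hF
theorem PR.dia1 {F : α → BForm} (hF : PR F) : PR fun a => BForm.dia1 (F a) :=
  Primrec₂.natPair.comp (Primrec.const 4) hF
theorem PR.const (φ : BForm) : PR fun _ : α => φ := Primrec.const _
theorem PR.imp {F G : α → BForm} (hF : PR F) (hG : PR G) : PR fun a => BForm.imp (F a) (G a) :=
  (hF.and hG.neg).neg
theorem PR.box0 {F : α → BForm} (hF : PR F) : PR fun a => BForm.box0 (F a) := hF.neg.dia0.neg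
theorem PR.box1 {F : α → BForm} (hF : PR F) : PR fun a => BForm.box1 (F a) := hF.neg.dia1.neg
theorem PR.boxP0 {F : α → BForm} (hF : PR F) : PR fun a => BForm.boxP0 (F a) := hF.and hF.box0
theorem PR.boxP1 {F : α → BForm} (hF : PR F) : PR fun a => BForm.boxP1 (F a) := hF.and hF.box1
theorem PR.diaP0 {F : α → BForm} (hF : PR F) : PR fun a => diaP0 (F a) := hF.neg.boxP0.neg
theorem PR.diaP1 {F : α → BForm} (hF : PR F) : PR fun a => diaP1 (F a) := hF.neg.boxP1.neg
theorem PR.ite {c : α → Prop} [DecidablePred c] {F G : α → BForm} (hc : PrimrecPred c)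
    (hF : PR F) (hG : PR G) : PR fun a => if c a then F a else G a := by
  refine (Primrec.ite hc hF hG).of_eq fun a => ?_
  by_cases h : c a <;> simp [h]
theorem PR.comp {F : β → BForm} (hF : PR F) {f : α → β} (hf : Primrec f) : PR fun a => F (f a) :=
  Primrec.comp (f := fun b => encodeB (F b)) hF hf

theorem encode_allF {L : List β} {F : β → BForm} : encodeB (allF L F) =
    (L.map fun t => encodeB (F t)).foldr (fun a b => Nat.pair 2 (Nat.pair a b)) (encodeB BForm.top) := by
  induction L with
  | nil => rfl
  | cons a l ih =>
    simp only [allF, List.map_cons, List.foldr_cons, encodeB] at ih ⊢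
    rw [ih]

theorem PR.allF {L : α → List β} (hL : Primrec L) {F : α × β → BForm} (hF : PR F) :
    PR fun a => allF (L a) fun t => F (a, t) := by
  have h1 : Primrec₂ fun (a : α) (t : β) => encodeB (F (a, t)) := hF
  have h2 := Primrec.list_map hL h1
  have h3 : Primrec₂ fun (_ : α) (p : ℕ × ℕ) => Nat.pair 2 (Nat.pair p.1 p.2) :=
    (Primrec₂.natPair.comp (Primrec.const 2)
      (Primrec₂.natPair.comp (Primrec.fst.comp Primrec.snd) (Primrec.snd.comp Primrec.snd)))
  exact (Primrec.list_foldr h2 (Primrec.const (encodeB BForm.top)) h3).of_eq fun a => encode_allF.symm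
theorem PR.exF {L : α → List β} (hL : Primrec L) {F : α × β → BForm} (hF : PR F) :
    PR fun a => exF (L a) fun t => F (a, t) :=
  (PR.allF hL hF.neg).neg

theorem PR.vS {t : α → Ins} (ht : Primrec t) : PR fun a => vS (t a) :=
  PR.var (Primrec.nat_mul.comp (Primrec.const 2) (Primrec.encode.comp ht))
theorem PR.vN {t : α → Ins} (ht : Primrec t) : PR fun a => vN (t a) :=
  PR.var (Primrec.succ.comp (Primrec.nat_mul.comp (Primrec.const 2) (Primrec.encode.comp ht)))

theorem prim_ins1 {t : α → Ins} (ht : Primrec t) : Primrec fun a => (t a).1 := Primrec.fst.comp ht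
theorem prim_ins2 {t : α → Ins} (ht : Primrec t) : Primrec fun a => (t a).2.1 :=
  Primrec.fst.comp (Primrec.snd.comp ht)
theorem prim_ins3 {t : α → Ins} (ht : Primrec t) : Primrec fun a => (t a).2.2 :=
  Primrec.snd.comp (Primrec.snd.comp ht)

theorem prim_counter : Primrec CMOp.counter := by
  have h2 : Primrec fun o : ℕ ⊕ ℕ => Sum.casesOn (motive := fun _ => ℕ) o id id :=
    Primrec.sumCasesOn Primrec.id Primrec₂.right Primrec₂.right
  refine (Primrec.sumCasesOn (f := fun o : CMOp => o) (g := fun _ i => i)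
    (h := fun _ (o : ℕ ⊕ ℕ) => Sum.casesOn (motive := fun _ => ℕ) o id id)
    Primrec.id Primrec₂.right (h2.comp Primrec₂.right)).of_eq fun o => ?_
  rcases o with i | i | i <;> rfl

variable {L : α → List Ins} (hL : Primrec L)

theorem PR.nextF (hL : Primrec L) {q : α → ℕ} (hq : Primrec q) : PR fun a => nextF (L a) (q a) :=
  PR.exF hL (F := fun p : α × Ins => if p.2.1 = q p.1 then HK.diaP1 (HK.vN p.2) else BForm.bot)
    (PR.ite (Primrec.eq.comp (prim_ins1 Primrec.snd) (hq.comp Primrec.fst))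
      (PR.vN Primrec.snd).diaP1 (PR.const _))
theorem PR.incF (hL : Primrec L) {i : α → ℕ} (hi : Primrec i) : PR fun a => incF (L a) (i a) :=
  PR.exF hL (F := fun p : α × Ins => if p.2.2.1 = Sum.inl (i p.1) then HK.diaP0 (HK.vS p.2) else BForm.bot)
    (PR.ite (Primrec.eq.comp (prim_ins2 Primrec.snd) (Primrec.sumInl.comp (hi.comp Primrec.fst)))
      (PR.vS Primrec.snd).diaP0 (PR.const _))
theorem PR.decF (hL : Primrec L) {i : α → ℕ} (hi : Primrec i) : PR fun a => decF (L a) (i a) :=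
  PR.exF hL (F := fun p : α × Ins => if p.2.2.1 = Sum.inr (Sum.inl (i p.1)) then HK.diaP0 (HK.vS p.2) else BForm.bot)
    (PR.ite (Primrec.eq.comp (prim_ins2 Primrec.snd)
      (Primrec.sumInr.comp (Primrec.sumInl.comp (hi.comp Primrec.fst))))
      (PR.vS Primrec.snd).diaP0 (PR.const _))
theorem PR.cntF (hL : Primrec L) {i : α → ℕ} (hi : Primrec i) : PR fun a => cntF (L a) (i a) :=
  (PR.incF hL hi).and (PR.decF hL hi).neg
theorem PR.preF (hL : Primrec L) {t : α → Ins} (ht : Primrec t) : PR fun a => preF (L a) (t a) := by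
  have hc : Primrec fun a => CMOp.counter (t a).2.1 := prim_counter.comp (prim_ins2 ht)
  exact PR.ite (Primrec.eq.comp (prim_ins2 ht) (Primrec.sumInl.comp hc))
    ((PR.incF hL hc).neg.and (PR.decF hL hc).neg)
    (PR.ite (Primrec.eq.comp (prim_ins2 ht) (Primrec.sumInr.comp (Primrec.sumInl.comp hc)))
      (PR.cntF hL hc) (PR.cntF hL hc).neg.boxP1)
theorem PR.uniqF {v : Ins → BForm} (hv : PR v) {t t' : α → Ins} (ht : Primrec t) (ht' : Primrec t') :
    PR fun a => uniqF v (t a) (t' a) :=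
  (hv.comp ht).imp ((PR.ite (Primrec.eq.comp ht ht') (PR.const _) (hv.comp ht').neg).and
    (hv.comp ht').neg.box1)
theorem PR.pairF {t t' : α → Ins} (ht : Primrec t) (ht' : Primrec t') :
    PR fun a => pairF (t a) (t' a) := by
  refine ((PR.uniqF (PR.vS Primrec.id) ht ht').and (PR.uniqF (PR.vN Primrec.id) ht ht')).and (PR.and ?_ ?_)
  · exact (PR.vS ht).imp (((PR.vS ht).neg.and (PR.vS ht').diaP1).imp (PR.vS ht).neg.box0).box0
  · exact (PR.vN ht').imp ((((PR.vN ht).dia0).and (PR.vS ht).diaP0.neg).imp (PR.vN ht)).boxP1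
theorem PR.oneF (hL : Primrec L) {t : α → Ins} (ht : Primrec t) : PR fun a => oneF (L a) (t a) :=
  ((PR.vS ht).imp ((PR.vN ht).dia0.and (PR.nextF hL (prim_ins3 ht)))).and
    ((PR.vN ht).imp ((PR.vS ht).diaP0.neg.and (PR.preF hL ht)))
theorem PR.globF (hL : Primrec L) : PR fun a => globF (L a) := by
  have h1 : PR fun p : α × Ins => HK.allF (L p.1) fun t' => HK.pairF p.2 t' :=
    PR.allF (hL.comp Primrec.fst) (F := fun p : (α × Ins) × Ins => HK.pairF p.1.2 p.2)
      (PR.pairF (Primrec.snd.comp Primrec.fst) Primrec.snd)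
  exact PR.allF hL ((PR.oneF (hL.comp Primrec.fst) Primrec.snd).and h1)
theorem PR.rootF (hL : Primrec L) {q : α → ℕ} (hq : Primrec q) : PR fun a => rootF (L a) (q a) := by
  refine PR.and (PR.dia0 (PR.and (PR.boxP1 ?_) (PR.nextF hL hq))) (PR.and (PR.boxP1 ?_) (PR.globF hL).box0.boxP1)
  · exact PR.allF hL (F := fun p => BForm.neg (HK.diaP0 (HK.vS p.2))) (PR.vS Primrec.snd).diaP0.neg
  · exact PR.allF hL (F := fun p => BForm.imp (BForm.dia0 (HK.vN p.2)) (BForm.dia0 (HK.vS p.2)))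
      ((PR.vN Primrec.snd).dia0.imp (PR.vS Primrec.snd).dia0)
end PR

theorem encodeB_inj : ∀ φ ψ : BForm, encodeB φ = encodeB ψ → φ = ψ := by
  intro φ
  induction φ with
  | var n => intro ψ h; cases ψ <;> simp [encodeB, Nat.pair_eq_pair] at h ⊢; exact h
  | neg φ ih => intro ψ h; cases ψ <;> simp [encodeB, Nat.pair_eq_pair] at h ⊢; exact ih _ h
  | and φ χ ih ih' =>
    intro ψ h; cases ψ <;> simp [encodeB, Nat.pair_eq_pair] at h ⊢; exact ⟨ih _ h.1, ih' _ h.2⟩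
  | dia0 φ ih => intro ψ h; cases ψ <;> simp [encodeB, Nat.pair_eq_pair] at h ⊢; exact ih _ h
  | dia1 φ ih => intro ψ h; cases ψ <;> simp [encodeB, Nat.pair_eq_pair] at h ⊢; exact ih _ h

theorem encodeB_ne (φ : BForm) : encodeB φ ≠ Nat.pair 5 0 := by
  cases φ <;> simp [encodeB, Nat.pair_eq_pair]

theorem primrecPred_mem {α : Type} [Primcodable α] {f : α → ℕ} {L : α → List ℕ} (hf : Primrec f)
    (hL : Primrec L) : PrimrecPred fun a => f a ∈ L a := by
  refine ((PrimrecRel.exists_mem_list (R := fun a b : ℕ => a = b) Primrec.eq).comp hL hf).of_eq fun a => ?_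
  simp

theorem primrecPred_CMWF : PrimrecPred CMWF := by
  have e1 : Primrec fun M : CMDesc => M.1 := Primrec.fst
  have e2 : Primrec fun M : CMDesc => M.2.1 := Primrec.fst.comp Primrec.snd
  have e3 : Primrec fun M : CMDesc => M.2.2.1 := Primrec.fst.comp (Primrec.snd.comp Primrec.snd)
  have e4 : Primrec fun M : CMDesc => M.2.2.2 := Primrec.snd.comp (Primrec.snd.comp Primrec.snd)
  refine PrimrecPred.and (Primrec.nat_lt.comp (Primrec.const 1) e1) (PrimrecPred.and ?_ (PrimrecPred.and ?_ ?_))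
  · exact (PrimrecRel.forall_mem_list (R := fun (q : ℕ) (n : ℕ) => q < n) Primrec.nat_lt).comp e3 e2
  · refine (PrimrecRel.forall_mem_list (R := fun (t : Ins) (M : CMDesc) =>
      t.1 < M.2.1 ∧ t.1 ∉ M.2.2.1 ∧ t.2.2 < M.2.1 ∧ CMOp.counter t.2.1 < M.1) ?_).comp e4 Primrec.id
    have a1 : Primrec fun p : Ins × CMDesc => p.1 := Primrec.fst
    have a2 : Primrec fun p : Ins × CMDesc => p.2 := Primrec.snd
    exact (Primrec.nat_lt.comp (prim_ins1 a1) (e2.comp a2)).and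
      ((primrecPred_mem (prim_ins1 a1) (e3.comp a2)).not.and
      ((Primrec.nat_lt.comp (prim_ins3 a1) (e2.comp a2)).and
      (Primrec.nat_lt.comp (prim_counter.comp (prim_ins2 a1)) (e1.comp a2))))
  · have h1 : PrimrecRel fun (q : ℕ) (M : CMDesc) => q ∈ M.2.2.1 ∨ ∃ t ∈ M.2.2.2, t.1 = q :=
      (primrecPred_mem Primrec.fst (e3.comp Primrec.snd)).or
        ((PrimrecRel.exists_mem_list (R := fun (t : Ins) (q : ℕ) => t.1 = q)
          (Primrec.eq.comp (prim_ins1 Primrec.fst) Primrec.snd)).comp (e4.comp Primrec.snd) Primrec.fst)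
    refine ((PrimrecRel.forall_mem_list h1).comp (g := fun M : CMDesc => M) (Primrec.list_range.comp e2) Primrec.id).of_eq fun M => ?_
    simp only [List.mem_range]
    refine forall_congr' fun q => forall_congr' fun _ => ?_
    exact or_iff_not_imp_left

theorem manyOne_main {C : Frame → Prop} (hC : ∀ F, C F → WeakOrd F.R)
    (hchain : ∃ F, C F ∧ HasOmegaPlusOneChain F) :
    ManyOneReducible CMNonTerm (BCodes (DecDiffSat C)) := by
  classical
  refine ⟨fun p => if CMWF p.1 then encodeB (rootF p.1.2.2.2 p.2) else Nat.pair 5 0, ?_, ?_⟩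
  · refine Primrec.to_comp (Primrec.ite (primrecPred_CMWF.comp Primrec.fst) ?_ (Primrec.const _))
    exact PR.rootF (Primrec.snd.comp (Primrec.snd.comp (Primrec.snd.comp Primrec.fst))) Primrec.snd
  · intro p
    simp only [CMNonTerm]
    split_ifs with h
    · simp only [h, true_and]
      constructor
      · intro hr; exact ⟨_, rfl, sat_of_run hchain hr⟩
      · rintro ⟨φ, e, hφ⟩
        rw [encodeB_inj _ _ e] at hφ
        exact run_of_sat hC hφ
    · simp only [h, false_and, false_iff]
      rintro ⟨φ, e, _⟩
      exact encodeB_ne φ e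

/-! ## Counter machine non-termination is undecidable -/

/-- Deterministic machine instructions. -/
inductive MI : Type
  | inc : ℕ → ℕ → MI
  | jzd : ℕ → ℕ → ℕ → MI

/-- Deterministic step with program `G`. -/
def DStep (G : ℕ → Option MI) (σ σ' : CMConfig) : Prop :=
  match G σ.1 with
  | none => False
  | some (MI.inc r q) => σ' = (q, Function.update σ.2 r (σ.2 r + 1))
  | some (MI.jzd r qz qd) =>
    (σ.2 r = 0 ∧ σ' = (qz, σ.2)) ∨ (σ.2 r ≠ 0 ∧ σ' = (qd, Function.update σ.2 r (σ.2 r - 1)))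

theorem DStep.det {G σ σ₁ σ₂} (h1 : DStep G σ σ₁) (h2 : DStep G σ σ₂) : σ₁ = σ₂ := by
  unfold DStep at h1 h2
  split at h1
  · exact h1.elim
  · rename_i e; rw [e] at h2; simp only at h2; rw [h1, h2]
  · rename_i e
    rw [e] at h2
    simp only at h2
    rcases h1 with ⟨a, rfl⟩ | ⟨a, rfl⟩ <;> rcases h2 with ⟨b, rfl⟩ | ⟨b, rfl⟩ <;> first | rfl | contradiction

/-- While programs. -/
inductive LP : Type
  | skip : LP
  | inc : ℕ → LP
  | seq : LP → LP → LP
  | loop : ℕ → LP → LP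

/-- Big step semantics. -/
inductive Exec : LP → (ℕ → ℕ) → (ℕ → ℕ) → Prop
  | skip (c) : Exec LP.skip c c
  | inc (r c) : Exec (LP.inc r) c (Function.update c r (c r + 1))
  | seq {p q c c' c''} : Exec p c c' → Exec q c' c'' → Exec (LP.seq p q) c c''
  | loop0 {r p c} : c r = 0 → Exec (LP.loop r p) c c
  | loopS {r p c c' c''} : c r ≠ 0 → Exec p (Function.update c r (c r - 1)) c' →
      Exec (LP.loop r p) c' c'' → Exec (LP.loop r p) c c''

def LP.size : LP → ℕ
  | skip => 0
  | inc _ => 1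
  | seq p q => p.size + q.size
  | loop _ p => p.size + 2

/-- Compilation at a given start state. -/
def LP.comp : LP → ℕ → ℕ → Option MI
  | skip, _ => fun _ => none
  | inc r, s => fun _ => some (MI.inc r (s+1))
  | seq p q, s => fun k => if k < s + p.size then p.comp s k else q.comp (s + p.size) k
  | loop r p, s => fun k =>
    if k = s ∨ k = s + 1 + p.size then some (MI.jzd r (s + p.size + 2) (s+1)) else p.comp (s+1) k

def MI.Bd (b : ℕ) : MI → Prop
  | inc _ q => q ≤ b
  | jzd _ q q' => q ≤ b ∧ q' ≤ b

theorem MI.Bd.mono {b b' : ℕ} {i : MI} (h : i.Bd b) (hb : b ≤ b') : i.Bd b' := by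
  cases i with
  | inc => exact le_trans h hb
  | jzd => exact ⟨le_trans h.1 hb, le_trans h.2 hb⟩

theorem LP.comp_bd (p : LP) : ∀ s k, s ≤ k → k < s + p.size → ∃ i, p.comp s k = some i ∧ i.Bd (s + p.size) := by
  induction p with
  | skip => intro s k h1 h2; simp [LP.size] at h2; omega
  | inc r => intro s k h1 h2; exact ⟨_, rfl, le_rfl⟩
  | seq p q ihp ihq =>
    intro s k h1 h2
    simp only [LP.size] at h2 ⊢
    simp only [LP.comp]
    split_ifs with h
    · obtain ⟨i, e, hi⟩ := ihp s k h1 h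
      exact ⟨i, e, hi.mono (by omega)⟩
    · obtain ⟨i, e, hi⟩ := ihq (s + p.size) k (by omega) (by omega)
      exact ⟨i, e, hi.mono (by omega)⟩
  | loop r p ih =>
    intro s k h1 h2
    simp only [LP.size] at h2 ⊢
    simp only [LP.comp]
    split_ifs with h
    · exact ⟨_, rfl, by simp only [MI.Bd]; omega⟩
    · obtain ⟨i, e, hi⟩ := ih (s + 1) k (by omega) (by omega)
      exact ⟨i, e, hi.mono (by omega)⟩

open Relation in
theorem Exec.reach {G : ℕ → Option MI} {p : LP} {c c' : ℕ → ℕ} (h : Exec p c c') :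
    ∀ s, (∀ k, s ≤ k → k < s + p.size → G k = p.comp s k) →
      ReflTransGen (DStep G) (s, c) (s + p.size, c') := by
  induction h with
  | skip c => intro s _; exact ReflTransGen.refl
  | inc r c =>
    intro s hG
    refine ReflTransGen.single ?_
    have := hG s le_rfl (by simp [LP.size])
    simp [DStep, this, LP.comp, LP.size]
  | @seq p q c c' c'' _ _ ih1 ih2 =>
    intro s hG
    simp only [LP.size] at hG ⊢
    have h1 := ih1 s fun k hk hk' => by
      rw [hG k hk (by omega)]; exact if_pos hk'
    have h2 := ih2 (s + p.size) fun k hk hk' => by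
      rw [hG k (by omega) (by omega)]; exact if_neg (by omega)
    rw [← add_assoc]
    exact h1.trans h2
  | @loop0 r p c h0 =>
    intro s hG
    refine ReflTransGen.single ?_
    have := hG s le_rfl (by simp [LP.size])
    simp [DStep, this, LP.comp, LP.size, h0]
    omega
  | @loopS r p c c' c'' hne h1 h2 ih1 ih2 =>
    intro s hG
    have hs := hG s le_rfl (by simp [LP.size])
    have he := hG (s + 1 + p.size) (by omega) (by simp [LP.size]; omega)
    simp only [LP.comp, true_or, or_true, if_true] at hs he
    have hb := ih1 (s+1) fun k hk hk' => by
      rw [hG k (by omega) (by simp only [LP.size]; omega)]; exact if_neg (by omega)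
    have hl := ih2 s hG
    have hfirst : DStep G (s, c) (s+1, Function.update c r (c r - 1)) := by
      simp [DStep, hs, hne]
    refine ReflTransGen.head hfirst (hb.trans ?_)
    rcases hl.cases_head with e | ⟨x, hx, hx'⟩
    · have := congrArg Prod.fst e
      simp [LP.size] at this
    · refine ReflTransGen.head ?_ hx'
      unfold DStep at hx ⊢
      simp only [hs, he] at hx ⊢
      exact hx

/-! ### Programs for primitive recursive functions -/

theorem exec_loop {r : ℕ} {p : LP} (Inv : ℕ → (ℕ → ℕ) → Prop) (N : ℕ)
    (hr : ∀ j c, Inv j c → c r = N - j)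
    (hp : ∀ j c, j < N → Inv j c → ∃ c', Exec p (Function.update c r (c r - 1)) c' ∧ Inv (j+1) c')
    {c : ℕ → ℕ} (h0 : Inv 0 c) : ∃ c', Exec (LP.loop r p) c c' ∧ Inv N c' := by
  have key : ∀ d j c, j + d = N → Inv j c → ∃ c', Exec (LP.loop r p) c c' ∧ Inv N c' := by
    intro d
    induction d with
    | zero =>
      intro j c hj hI
      have : j = N := by omega
      subst this
      exact ⟨c, Exec.loop0 (by rw [hr j c hI]; omega), hI⟩
    | succ d ih =>
      intro j c hj hI
      obtain ⟨c1, e1, hI1⟩ := hp j c (by omega) hI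
      obtain ⟨c2, e2, hI2⟩ := ih (j+1) c1 (by omega) hI1
      exact ⟨c2, Exec.loopS (by rw [hr j c hI]; omega) e1 e2, hI2⟩
  exact key N 0 c (by omega) h0

def LP.zero (r : ℕ) : LP := LP.loop r LP.skip

theorem exec_zero (r : ℕ) (c : ℕ → ℕ) :
    ∃ c', Exec (LP.zero r) c c' ∧ c' r = 0 ∧ ∀ x, x ≠ r → c' x = c x := by
  obtain ⟨c', h1, h2, h3⟩ := exec_loop (r := r) (p := LP.skip)
    (fun j c' => c' r = c r - j ∧ ∀ x, x ≠ r → c' x = c x) (c r) (fun j c h => h.1)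
    (fun j c' hj hI => ⟨_, Exec.skip _, by simp [hI.1]; omega, fun x hx => by simp [hx, hI.2 x hx]⟩)
    (c := c) ⟨by omega, fun _ _ => rfl⟩
  exact ⟨c', h1, by omega, h3⟩

/-- Copy register `a` to `b` using scratch register `t`. -/
def LP.copy (a b t : ℕ) : LP :=
  LP.seq (LP.zero b) (LP.seq (LP.zero t)
    (LP.seq (LP.loop a (LP.seq (LP.inc b) (LP.inc t))) (LP.loop t (LP.inc a))))

theorem exec_copy {a b t : ℕ} (hab : a ≠ b) (hat : a ≠ t) (hbt : b ≠ t) (c : ℕ → ℕ) :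
    ∃ c', Exec (LP.copy a b t) c c' ∧ c' b = c a ∧ ∀ x, x ≠ b → x ≠ t → c' x = c x := by
  obtain ⟨c1, e1, z1, o1⟩ := exec_zero b c
  obtain ⟨c2, e2, z2, o2⟩ := exec_zero t c1
  obtain ⟨c3, e3, h3a, h3b, h3t, h3⟩ := exec_loop (r := a) (p := LP.seq (LP.inc b) (LP.inc t))
    (fun j c' => c' a = c a - j ∧ c' b = j ∧ c' t = j ∧ ∀ x, x ≠ a → x ≠ b → x ≠ t → c' x = c x) (c a)
    (fun j c h => h.1)
    (fun j c' hj hI => ⟨_, Exec.seq (Exec.inc _ _) (Exec.inc _ _), by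
      obtain ⟨i1, i2, i3, i4⟩ := hI
      refine ⟨?_, ?_, ?_, ?_⟩
      · simp [hab, hat, i1]; omega
      · simp [hbt, hab.symm, i2]
      · simp [hbt.symm, hat.symm, i3]
      · intro x h1 h2 h3; simp [h1, h2, h3, i4]⟩)
    (c := c2) ⟨by rw [o2 _ hat, o1 _ hab]; omega, by rw [o2 _ hbt, z1], z2,
      fun x h1 h2 h3 => by rw [o2 x h3, o1 x h2]⟩
  obtain ⟨c4, e4, h4t, h4a, h4⟩ := exec_loop (r := t) (p := LP.inc a)
    (fun j c' => c' t = c a - j ∧ c' a = j ∧ ∀ x, x ≠ a → x ≠ t → c' x = c3 x) (c a)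
    (fun j c h => h.1)
    (fun j c' hj hI => ⟨_, Exec.inc _ _, by
      obtain ⟨i1, i2, i4⟩ := hI
      refine ⟨?_, ?_, ?_⟩
      · simp [hat.symm, i1]; omega
      · simp [hat, i2]
      · intro x h1 h2; simp [h1, h2, i4]⟩)
    (c := c3) ⟨by rw [h3t]; omega, by rw [h3a]; omega, fun _ _ _ => rfl⟩
  refine ⟨c4, Exec.seq e1 (Exec.seq e2 (Exec.seq e3 e4)), ?_, ?_⟩
  · rw [h4 b hab.symm hbt, h3b]
  · intro x h1 h2
    by_cases hx : x = a
    · subst hx; exact h4a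
    · rw [h4 x hx h2, h3 x hx h1 h2]

/-- `p` computes `f` from the registers `args` to the register `out`, preserving all other
registers below `base`. -/
def Computes {n : ℕ} (f : List.Vector ℕ n → ℕ) (args : Fin n → ℕ) (out base : ℕ) (p : LP) : Prop :=
  ∀ c, ∃ c', Exec p c c' ∧ c' out = f (List.Vector.ofFn fun i => c (args i)) ∧
    ∀ r, r < base → r ≠ out → c' r = c r

theorem vec_ofFn_cons {n : ℕ} (f : Fin (n+1) → ℕ) :
    List.Vector.ofFn f = f 0 ::ᵥ List.Vector.ofFn (fun i => f i.succ) := by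
  rfl

theorem primrec_prog {n : ℕ} {f : List.Vector ℕ n → ℕ} (hf : Nat.Primrec' f) :
    ∀ (args : Fin n → ℕ) (out base : ℕ), (∀ i, args i < base) → (∀ i, args i ≠ out) → out < base →
      ∃ p, Computes f args out base p := by
  induction hf with
  | zero =>
    intro args out base _ _ _
    refine ⟨LP.zero out, fun c => ?_⟩
    obtain ⟨c', h1, h2, h3⟩ := exec_zero out c
    exact ⟨c', h1, h2, fun r _ hr => h3 r hr⟩
  | succ =>
    intro args out base h1 h2 h3
    refine ⟨LP.seq (LP.copy (args 0) out base) (LP.inc out), fun c => ?_⟩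
    obtain ⟨c', e1, e2, e3⟩ := exec_copy (h2 0) (h1 0).ne h3.ne c
    refine ⟨_, Exec.seq e1 (Exec.inc _ _), ?_, ?_⟩
    · simp [e2]
    · intro r hr hr'
      simp [hr', e3 r hr' hr.ne]
  | get i =>
    intro args out base h1 h2 h3
    refine ⟨LP.copy (args i) out base, fun c => ?_⟩
    obtain ⟨c', e1, e2, e3⟩ := exec_copy (h2 i) (h1 i).ne h3.ne c
    refine ⟨_, e1, ?_, fun r hr hr' => e3 r hr' hr.ne⟩
    simp [e2]
  | @comp n m f g hf hg ihf ihg =>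
    intro args out base h1 h2 h3
    have key : ∀ k, k ≤ m → ∃ p, ∀ c, ∃ c', Exec p c c' ∧
        (∀ i : Fin m, i.1 < k → c' (base + i.1) = g i (List.Vector.ofFn fun j => c (args j))) ∧
        ∀ r, r < base → c' r = c r := by
      intro k
      induction k with
      | zero =>
        intro _
        exact ⟨LP.skip, fun c => ⟨c, Exec.skip c, fun i hi => absurd hi (by omega), fun _ _ => rfl⟩⟩
      | succ k ih =>
        intro hk
        obtain ⟨p, hp⟩ := ih (by omega)
        obtain ⟨p', hp'⟩ := ihg ⟨k, by omega⟩ args (base + k) (base + m)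
          (fun i => by have := h1 i; omega) (fun i => by have := h1 i; omega) (by omega)
        refine ⟨LP.seq p p', fun c => ?_⟩
        obtain ⟨c1, e1, a1, b1⟩ := hp c
        obtain ⟨c2, e2, a2, b2⟩ := hp' c1
        refine ⟨c2, Exec.seq e1 e2, ?_, ?_⟩
        · intro i hi
          have hargs : (fun j => c1 (args j)) = fun j => c (args j) := funext fun j => b1 _ (h1 j)
          by_cases e : i.1 = k
          · obtain ⟨i, hi'⟩ := i
            simp only at e
            subst e
            rw [← hargs]; exact a2
          · rw [b2 _ (by omega) (by omega), a1 i (by omega)]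
        · intro r hr
          rw [b2 r (by omega) (by omega), b1 r hr]
    obtain ⟨p, hp⟩ := key m le_rfl
    obtain ⟨p', hp'⟩ := ihf (fun i => base + i.1) out (base + m) (fun i => by omega)
      (fun i => by omega) (by omega)
    refine ⟨LP.seq p p', fun c => ?_⟩
    obtain ⟨c1, e1, a1, b1⟩ := hp c
    obtain ⟨c2, e2, a2, b2⟩ := hp' c1
    refine ⟨c2, Exec.seq e1 e2, ?_, ?_⟩
    · rw [a2]
      congr 2
      funext i
      exact a1 i i.2
    · intro r hr hr'
      rw [b2 r (by omega) hr', b1 r hr]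
  | @prec n f g hf hg ihf ihg =>
    intro args out base h1 h2 h3
    obtain ⟨pf, hpf⟩ := ihf (fun i => args i.succ) (base+1) (base+4)
      (fun i => by have := h1 i.succ; omega) (fun i => by have := h1 i.succ; omega) (by omega)
    obtain ⟨pg, hpg⟩ := ihg (Fin.cons base (Fin.cons (base+1) fun i => args i.succ)) (base+3) (base+4)
      (by
        intro i
        refine Fin.cases (by simp) (fun i => ?_) i
        refine Fin.cases (by simp) (fun i => ?_) i
        have := h1 i.succ
        simp only [Fin.cons_succ]
        omega)
      (by
        intro i
        refine Fin.cases (by simp) (fun i => ?_) i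
        refine Fin.cases (by simp) (fun i => ?_) i
        have := h1 i.succ
        simp only [Fin.cons_succ]
        omega) (by omega)
    have ha0 := h1 0
    refine ⟨LP.seq pf (LP.seq (LP.copy (args 0) (base+2) (base+4)) (LP.seq (LP.zero base)
      (LP.seq (LP.loop (base+2) (LP.seq pg (LP.seq (LP.copy (base+3) (base+1) (base+4)) (LP.inc base))))
        (LP.copy (base+1) out (base+4))))), fun c => ?_⟩
    obtain ⟨c1, e1, a1, b1⟩ := hpf c
    obtain ⟨c2, e2, a2, b2⟩ := exec_copy (a := args 0) (b := base+2) (t := base+4) (by omega) (by omega)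
      (by omega) c1
    obtain ⟨c3, e3, a3, b3⟩ := exec_zero base c2
    set tl : List.Vector ℕ n := List.Vector.ofFn fun i => c (args i.succ) with htl
    set F : ℕ → ℕ := fun j => Nat.rec (f tl) (fun y IH => g (y ::ᵥ IH ::ᵥ tl)) j with hF
    obtain ⟨c4, e4, i1, i2, i3, i4⟩ := exec_loop (r := base+2)
      (p := LP.seq pg (LP.seq (LP.copy (base+3) (base+1) (base+4)) (LP.inc base)))
      (fun j c' => c' (base+2) = c (args 0) - j ∧ c' base = j ∧ c' (base+1) = F j ∧
        ∀ r, r < base → c' r = c r) (c (args 0)) (fun j c h => h.1)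
      (by
        rintro j c' hj ⟨i1, i2, i3, i4⟩
        obtain ⟨d1, x1, y1, z1⟩ := hpg (Function.update c' (base+2) (c' (base+2) - 1))
        obtain ⟨d2, x2, y2, z2⟩ := exec_copy (a := base+3) (b := base+1) (t := base+4) (by omega) (by omega)
          (by omega) d1
        refine ⟨_, Exec.seq x1 (Exec.seq x2 (Exec.inc _ _)), ?_, ?_, ?_, ?_⟩
        · rw [Function.update_of_ne (by omega), z2 _ (by omega) (by omega), z1 _ (by omega) (by omega)]
          simp [i1]; omega
        · rw [Function.update_self, z2 _ (by omega) (by omega), z1 _ (by omega) (by omega),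
            Function.update_of_ne (by omega), i2]
        · rw [Function.update_of_ne (by omega), y2, y1, vec_ofFn_cons, vec_ofFn_cons]
          simp only [Fin.cons_zero, Fin.cons_succ]
          rw [Function.update_of_ne (by omega), Function.update_of_ne (by omega), i2, i3]
          have : (fun i : Fin n => Function.update c' (base+2) (c' (base+2) - 1) (args i.succ)) =
              fun i => c (args i.succ) := by
            funext i
            have := h1 i.succ
            rw [Function.update_of_ne (by omega), i4 _ (by omega)]
          rw [this]
        · intro r hr
          rw [Function.update_of_ne (by omega), z2 _ (by omega) (by omega), z1 _ (by omega) (by omega),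
            Function.update_of_ne (by omega), i4 r hr])
      (c := c3) (by
        refine ⟨?_, a3, ?_, ?_⟩
        · rw [b3 _ (by omega), a2, b1 _ (by omega) (by omega)]; omega
        · rw [b3 _ (by omega), b2 _ (by omega) (by omega), a1]
          rfl
        · intro r hr
          rw [b3 _ (by omega), b2 _ (by omega) (by omega), b1 _ (by omega) (by omega)])
    obtain ⟨c5, e5, a5, b5⟩ := exec_copy (a := base+1) (b := out) (t := base+4) (by omega) (by omega)
      (by omega) c4
    refine ⟨c5, Exec.seq e1 (Exec.seq e2 (Exec.seq e3 (Exec.seq e4 e5))), ?_, ?_⟩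
    · rw [a5, i3, vec_ofFn_cons]
      rfl
    · intro r hr hr'
      rw [b5 r hr' (by omega), i4 r hr]

/-- The nondeterministic instructions corresponding to a deterministic one. -/
def opsOf : Option MI → List (CMOp × ℕ)
  | none => []
  | some (MI.inc r q) => [(Sum.inl r, q)]
  | some (MI.jzd r qz qd) => [(Sum.inr (Sum.inr r), qz), (Sum.inr (Sum.inl r), qd)]

theorem cmstep_iff {M : CMDesc} {G : ℕ → Option MI}
    (h : ∀ q op q', (q, op, q') ∈ M.2.2.2 ↔ (op, q') ∈ opsOf (G q)) (σ σ' : CMConfig) :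
    CMStep M σ σ' ↔ DStep G σ σ' := by
  obtain ⟨q, c⟩ := σ
  obtain ⟨q', c'⟩ := σ'
  have hinc : ∀ r, (c' r = c r + 1 ∧ ∀ j, j ≠ r → c' j = c j) ↔ c' = Function.update c r (c r + 1) := by
    intro r
    constructor
    · rintro ⟨h1, h2⟩
      funext j
      by_cases hj : j = r
      · subst hj; simp [h1]
      · simp [hj, h2 j hj]
    · rintro rfl
      exact ⟨by simp, fun j hj => by simp [hj]⟩
  have hdec : ∀ r, (0 < c r ∧ c' r + 1 = c r ∧ ∀ j, j ≠ r → c' j = c j) ↔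
      c r ≠ 0 ∧ c' = Function.update c r (c r - 1) := by
    intro r
    constructor
    · rintro ⟨h0, h1, h2⟩
      refine ⟨by omega, ?_⟩
      funext j
      by_cases hj : j = r
      · subst hj; simp; omega
      · simp [hj, h2 j hj]
    · rintro ⟨h0, rfl⟩
      exact ⟨by omega, by simp; omega, fun j hj => by simp [hj]⟩
  unfold CMStep DStep
  simp only [h]
  rcases hG : G q with _ | ⟨r, q1⟩ | ⟨r, qz, qd⟩
  · simp [opsOf]
  · simp only [opsOf, List.mem_singleton, Prod.mk.injEq]
    constructor
    · rintro ⟨op, q2, ⟨rfl, rfl⟩, rfl, h3⟩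
      exact ⟨rfl, (hinc r).1 h3⟩
    · rintro ⟨rfl, h3⟩
      exact ⟨_, _, ⟨rfl, rfl⟩, rfl, (hinc r).2 h3⟩
  · simp only [opsOf, List.mem_cons, List.not_mem_nil, or_false, Prod.mk.injEq]
    constructor
    · rintro ⟨op, q2, ⟨rfl, rfl⟩ | ⟨rfl, rfl⟩, rfl, h3⟩
      · exact Or.inl ⟨h3.1, rfl, funext h3.2⟩
      · have := (hdec r).1 h3
        exact Or.inr ⟨this.1, rfl, this.2⟩
    · rintro (⟨h0, rfl, h3⟩ | ⟨h0, rfl, h3⟩)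
      · exact ⟨_, _, Or.inl ⟨rfl, rfl⟩, rfl, h0, fun j => by rw [h3]⟩
      · exact ⟨_, _, Or.inr ⟨rfl, rfl⟩, rfl, (hdec r).2 ⟨h0, h3⟩⟩

/-- An infinite run of a deterministic program. -/
def InfRun (G : ℕ → Option MI) (σ : CMConfig) : Prop :=
  ∃ ρ : ℕ → CMConfig, ρ 0 = σ ∧ ∀ n, DStep G (ρ n) (ρ (n+1))

theorem InfRun.reach {G σ τ} (hr : Relation.ReflTransGen (DStep G) σ τ) (h : InfRun G σ) :
    InfRun G τ := by
  induction hr with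
  | refl => exact h
  | tail _ hs ih =>
    obtain ⟨ρ, h0, h1⟩ := ih
    refine ⟨fun n => ρ (n+1), ?_, fun n => h1 (n+1)⟩
    have := h1 0
    rw [h0] at this
    exact this.det hs

theorem InfRun.not_none {G : ℕ → Option MI} {q c} (h : InfRun G (q, c)) : G q ≠ none := by
  obtain ⟨ρ, h0, h1⟩ := h
  have := h1 0
  rw [h0] at this
  intro e
  simp [DStep, e] at this

open Relation in
theorem infRun_of_set {G : ℕ → Option MI} (S : CMConfig → Prop)
    (hS : ∀ σ, S σ → ∃ τ, S τ ∧ TransGen (DStep G) σ τ) {σ : CMConfig}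
    (h : ∃ τ, S τ ∧ ReflTransGen (DStep G) σ τ) : InfRun G σ := by
  have step : ∀ x : {σ : CMConfig // ∃ τ, S τ ∧ ReflTransGen (DStep G) σ τ},
      ∃ y : {σ : CMConfig // ∃ τ, S τ ∧ ReflTransGen (DStep G) σ τ}, DStep G x.1 y.1 := by
    rintro ⟨x, τ, hτ, hx⟩
    have : ∃ τ', S τ' ∧ TransGen (DStep G) x τ' := by
      obtain ⟨τ', h1, h2⟩ := hS τ hτ
      exact ⟨τ', h1, TransGen.trans_right hx h2⟩
    obtain ⟨τ', h1, h2⟩ := this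
    obtain ⟨y, hy, hy'⟩ := TransGen.head'_iff.1 h2
    exact ⟨⟨y, τ', h1, hy'⟩, hy⟩
  choose f hf using step
  refine ⟨fun n => (f^[n] ⟨σ, h⟩).1, rfl, fun n => ?_⟩
  simp only [Function.iterate_succ_apply']
  exact hf _

/-- The step-bounded halting test. -/
def haltTest (m k : ℕ) : ℕ :=
  if (Nat.Partrec.Code.evaln k (Denumerable.ofNat Nat.Partrec.Code m) 0).isSome then 0 else 1

theorem haltTest_primrec : Primrec₂ haltTest := by
  have h1 : Primrec fun p : ℕ × ℕ => Nat.Partrec.Code.evaln p.2 (Denumerable.ofNat Nat.Partrec.Code p.1) 0 :=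
    Nat.Partrec.Code.primrec_evaln.comp
      (((Primrec.snd.pair ((Primrec.ofNat _).comp Primrec.fst))).pair (Primrec.const 0))
  have h2 : PrimrecPred fun p : ℕ × ℕ =>
      (Nat.Partrec.Code.evaln p.2 (Denumerable.ofNat Nat.Partrec.Code p.1) 0).isSome = true :=
    Primrec.primrecPred ((Primrec.option_isSome.comp h1).of_eq fun a => by simp)
  exact Primrec.ite h2 (Primrec.const 0) (Primrec.const 1)

theorem haltTest_iff (m : ℕ) :
    (∃ k, haltTest m k = 0) ↔ (Nat.Partrec.Code.eval (Denumerable.ofNat Nat.Partrec.Code m) 0).Dom := by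
  rw [Part.dom_iff_mem]
  constructor
  · rintro ⟨k, hk⟩
    unfold haltTest at hk
    split_ifs at hk with h
    · obtain ⟨x, hx⟩ := Option.isSome_iff_exists.1 h
      exact ⟨x, Nat.Partrec.Code.evaln_sound hx⟩
  · rintro ⟨x, hx⟩
    obtain ⟨k, hk⟩ := Nat.Partrec.Code.evaln_complete.1 hx
    refine ⟨k, if_pos ?_⟩
    rw [hk]; rfl

theorem haltProg : ∃ p : LP, ∀ c : ℕ → ℕ, ∃ c', Exec p c c' ∧ c' 2 = haltTest (c 0) (c 1) ∧
    c' 0 = c 0 ∧ c' 1 = c 1 := by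
  have h := Nat.Primrec'.prim_iff₂.2 haltTest_primrec
  obtain ⟨p, hp⟩ := primrec_prog h (fun i => i.1) 2 3 (fun i => by omega) (fun i => by omega) (by omega)
  refine ⟨p, fun c => ?_⟩
  obtain ⟨c', h1, h2, h3⟩ := hp c
  exact ⟨c', h1, h2, h3 0 (by omega) (by omega), h3 1 (by omega) (by omega)⟩

section Machine
variable (P : LP) (n : ℕ)

/-- The program of the machine for input `n`: first load `n`, then run `P`. -/
def mG (q : ℕ) : Option MI :=
  if q < P.size then P.comp 0 q
  else if q = P.size + 1 then some (MI.inc 2 0)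
  else if P.size + 2 ≤ q ∧ q < P.size + 2 + n then some (MI.inc 0 (q-1))
  else none

def mA : List (ℕ × CMOp × ℕ) :=
  (List.range P.size).flatMap fun q => (opsOf (P.comp 0 q)).map fun x => (q, x)

def mN : ℕ := 3 + ((mA P).map fun t => CMOp.counter t.2.1).sum

def mM : CMDesc :=
  (mN P, P.size + 2 + n, [P.size], mA P ++ (P.size + 1, Sum.inl 2, 0) ::
    (List.range n).map fun k => (P.size + 2 + k, Sum.inl 0, P.size + 1 + k))

theorem mem_mA (q op q') : (q, op, q') ∈ mA P ↔ q < P.size ∧ (op, q') ∈ opsOf (P.comp 0 q) := by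
  simp only [mA, List.mem_flatMap, List.mem_range, List.mem_map, Prod.mk.injEq]
  constructor
  · rintro ⟨a, ha, x, hx, rfl, rfl⟩
    exact ⟨ha, hx⟩
  · rintro ⟨h1, h2⟩
    exact ⟨q, h1, (op, q'), h2, rfl, rfl⟩

theorem mem_mM (q op q') : (q, op, q') ∈ (mM P n).2.2.2 ↔ (op, q') ∈ opsOf (mG P n q) := by
  simp only [mM, List.mem_append, mem_mA, List.mem_cons, List.mem_map, List.mem_range, Prod.mk.injEq]
  unfold mG
  split_ifs with h1 h2 h3
  · constructor
    · rintro (h | ⟨rfl, _⟩ | ⟨k, _, rfl, _⟩)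
      · exact h.2
      · omega
      · omega
    · intro h; exact Or.inl ⟨h1, h⟩
  · subst h2
    simp only [opsOf, List.mem_singleton, Prod.mk.injEq]
    constructor
    · rintro (h | ⟨_, h⟩ | ⟨k, _, h, _⟩)
      · exact absurd h.1 h1
      · exact h
      · omega
    · intro h; exact Or.inr (Or.inl ⟨trivial, h⟩)
  · simp only [opsOf, List.mem_singleton, Prod.mk.injEq]
    constructor
    · rintro (h | ⟨h, _⟩ | ⟨k, _, rfl, rfl, rfl⟩)
      · exact absurd h.1 h1
      · exact absurd h h2
      · exact ⟨rfl, by omega⟩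
    · rintro ⟨rfl, rfl⟩
      exact Or.inr (Or.inr ⟨q - (P.size + 2), by omega, by omega, rfl, by omega⟩)
  · simp only [opsOf, List.not_mem_nil, iff_false]
    rintro (h | ⟨h, _⟩ | ⟨k, hk, h, _⟩)
    · exact absurd h.1 h1
    · exact absurd h h2
    · omega

theorem opsOf_ne {i : MI} : ∃ x, x ∈ opsOf (some i) := by
  cases i <;> simp [opsOf]

theorem mM_wf : CMWF (mM P n) := by
  refine ⟨?_, ?_, ?_, ?_⟩
  · simp only [mM, mN]; omega
  · simp only [mM, List.mem_singleton]; omega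
  · rintro ⟨q, op, q'⟩ ht
    have hm := (mem_mM P n q op q').1 ht
    have hc : CMOp.counter op < mN P := by
      simp only [mM, List.mem_append, List.mem_cons, List.mem_map, List.mem_range, Prod.mk.injEq] at ht
      rcases ht with h | ⟨_, rfl, _⟩ | ⟨k, _, _, rfl, _⟩
      · have : CMOp.counter op ≤ ((mA P).map fun t => CMOp.counter t.2.1).sum :=
          List.le_sum_of_mem (List.mem_map.2 ⟨_, h, rfl⟩)
        unfold mN; omega
      · simp only [CMOp.counter, mN]; omega
      · simp only [CMOp.counter, mN]; omega
    have hq : q < P.size + 2 + n ∧ q ≠ P.size ∧ q' < P.size + 2 + n := by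
      unfold mG at hm
      split_ifs at hm with h1 h2 h3
      · obtain ⟨i, e, hi⟩ := P.comp_bd 0 q (by omega) (by omega)
        rw [e] at hm
        refine ⟨by omega, by omega, ?_⟩
        cases i <;> simp [opsOf] at hm <;> simp [MI.Bd] at hi <;> omega
      · simp [opsOf] at hm; omega
      · simp [opsOf] at hm; omega
      · simp [opsOf] at hm
    exact ⟨hq.1, by simpa [mM] using hq.2.1, hq.2.2, hc⟩
  · intro q hq hq'
    simp only [mM, List.mem_singleton] at hq hq'
    have : ∃ i, mG P n q = some i := by
      unfold mG
      split_ifs with h1 h2 h3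
      · obtain ⟨i, e, _⟩ := P.comp_bd 0 q (by omega) (by omega)
        exact ⟨i, e⟩
      · exact ⟨_, rfl⟩
      · exact ⟨_, rfl⟩
      · omega
    obtain ⟨i, e⟩ := this
    obtain ⟨x, hx⟩ := opsOf_ne (i := i)
    exact ⟨(q, x.1, x.2), (mem_mM P n q x.1 x.2).2 (by rw [e]; exact hx), rfl⟩

theorem mM_nonterm (q : ℕ) : CMNonTerm (mM P n, q) ↔ InfRun (mG P n) (zeroConfig q) := by
  simp only [CMNonTerm, mM_wf, true_and, cmstep_iff (mem_mM P n), InfRun]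

open Relation in
theorem mG_load : ∃ c : ℕ → ℕ, c 0 = n ∧ c 1 = 0 ∧ c 2 = 1 ∧
    ReflTransGen (DStep (mG P n)) (zeroConfig (P.size + 1 + n)) (0, c) := by
  have key : ∀ k, k ≤ n → ∀ c : ℕ → ℕ, c 0 + k = n → c 1 = 0 → c 2 = 0 →
      ∃ c' : ℕ → ℕ, c' 0 = n ∧ c' 1 = 0 ∧ c' 2 = 1 ∧
        ReflTransGen (DStep (mG P n)) (P.size + 1 + k, c) (0, c') := by
    intro k
    induction k with
    | zero =>
      intro _ c h0 h1 h2
      refine ⟨Function.update c 2 (c 2 + 1), by simpa using h0, by simpa using h1, by simp [h2],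
        ReflTransGen.single ?_⟩
      have : mG P n (P.size + 1 + 0) = some (MI.inc 2 0) := by
        unfold mG; rw [if_neg (by omega), if_pos (by omega)]
      simp [DStep, this]
    | succ k ih =>
      intro hk c h0 h1 h2
      obtain ⟨c', a, b, d, e⟩ := ih (by omega) (Function.update c 0 (c 0 + 1)) (by simp; omega)
        (by simpa using h1) (by simpa using h2)
      refine ⟨c', a, b, d, ReflTransGen.head ?_ e⟩
      have : mG P n (P.size + 1 + (k + 1)) = some (MI.inc 0 (P.size + 1 + k)) := by
        unfold mG; rw [if_neg (by omega), if_neg (by omega), if_pos (by omega)]; rfl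
      simp only [DStep, this]
  exact key n le_rfl (fun _ => 0) (by simp) rfl rfl

theorem mM_primrec : Primrec fun n : ℕ => ((mM P n, P.size + 1 + n) : CMDesc × ℕ) := by
  have hlist : Primrec fun n : ℕ => mA P ++ (P.size + 1, (Sum.inl 2 : CMOp), 0) ::
      (List.range n).map fun k => (P.size + 2 + k, (Sum.inl 0 : CMOp), P.size + 1 + k) := by
    refine Primrec.list_append.comp (Primrec.const _) (Primrec.list_cons.comp (Primrec.const _) ?_)
    refine Primrec.list_map Primrec.list_range ?_
    exact Primrec.pair (Primrec.nat_add.comp (Primrec.const _) Primrec.snd)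
      (Primrec.pair (Primrec.const _) (Primrec.nat_add.comp (Primrec.const _) Primrec.snd))
  exact Primrec.pair (Primrec.pair (Primrec.const _) (Primrec.pair
    (Primrec.nat_add.comp (Primrec.const _) Primrec.id) (Primrec.pair (Primrec.const _) hlist)))
    (Primrec.nat_add.comp (Primrec.const _) Primrec.id)

end Machine

open Relation in
theorem main_loop {p : LP} (hp : ∀ c : ℕ → ℕ, ∃ c', Exec p c c' ∧ c' 2 = haltTest (c 0) (c 1) ∧
    c' 0 = c 0 ∧ c' 1 = c 1) (n : ℕ) :
    InfRun (mG (LP.loop 2 (LP.seq p (LP.inc 1))) n)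
      (zeroConfig ((LP.loop 2 (LP.seq p (LP.inc 1))).size + 1 + n)) ↔ ¬ ∃ k, haltTest n k = 0 := by
  set B := LP.seq p (LP.inc 1) with hB
  set P := LP.loop 2 B with hP
  set G := mG P n with hG
  have hsize : P.size = B.size + 2 := rfl
  have hGP : ∀ k, 0 ≤ k → k < 0 + P.size → G k = P.comp 0 k := by
    intro k _ hk
    exact if_pos (by omega)
  have hbody : ∀ c : ℕ → ℕ, ∃ c', Exec B (Function.update c 2 (c 2 - 1)) c' ∧
      c' 2 = haltTest (c 0) (c 1) ∧ c' 0 = c 0 ∧ c' 1 = c 1 + 1 := by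
    intro c
    obtain ⟨c', e1, e2, e3, e4⟩ := hp (Function.update c 2 (c 2 - 1))
    refine ⟨_, Exec.seq e1 (Exec.inc _ _), ?_, ?_, ?_⟩
    · simpa using e2
    · simpa using e3
    · simpa using e4
  obtain ⟨c0, l0, l1, l2, hload⟩ := mG_load P n
  constructor
  · rintro hinf ⟨k, hk⟩
    have hex : ∀ d (c : ℕ → ℕ), c 0 = n → c 1 + d = k → ∃ c', Exec P c c' := by
      intro d
      induction d with
      | zero =>
        intro c h0 h1
        by_cases h2 : c 2 = 0
        · exact ⟨c, Exec.loop0 h2⟩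
        · obtain ⟨c', e1, e2, _, _⟩ := hbody c
          have : c' 2 = 0 := by rw [e2, h0, show c 1 = k by omega, hk]
          exact ⟨c', Exec.loopS h2 e1 (Exec.loop0 this)⟩
      | succ d ih =>
        intro c h0 h1
        by_cases h2 : c 2 = 0
        · exact ⟨c, Exec.loop0 h2⟩
        · obtain ⟨c', e1, _, e3, e4⟩ := hbody c
          obtain ⟨c'', e⟩ := ih c' (by omega) (by omega)
          exact ⟨c'', Exec.loopS h2 e1 e⟩
    obtain ⟨c', he⟩ := hex k c0 l0 (by omega)
    have hr := he.reach 0 hGP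
    refine InfRun.not_none ((hinf.reach hload).reach hr) ?_
    simp only [hG, mG]
    rw [if_neg (by omega), if_neg (by omega), if_neg (by omega)]
  · intro hno
    have hne : ∀ k, haltTest n k ≠ 0 := fun k hk => hno ⟨k, hk⟩
    refine infRun_of_set (fun σ => (σ.1 = 0 ∨ σ.1 = 0 + 1 + B.size) ∧ σ.2 0 = n ∧ σ.2 2 ≠ 0) ?_
      ⟨(0, c0), ⟨Or.inl rfl, l0, by simp [l2]⟩, hload⟩
    rintro ⟨q, c⟩ ⟨hq, h0, h2⟩
    simp only at hq h0 h2
    obtain ⟨c', e1, e2, e3, e4⟩ := hbody c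
    refine ⟨(0 + 1 + B.size, c'), ⟨Or.inr rfl, by simp only; omega, ?_⟩, ?_⟩
    · simp only; rw [e2, h0]; exact hne _
    · refine TransGen.head' (b := (0 + 1, Function.update c 2 (c 2 - 1))) ?_ ?_
      · have : G q = some (MI.jzd 2 (0 + B.size + 2) (0 + 1)) := by
          rw [hGP q (by omega) (by omega)]
          exact if_pos hq
        simp [DStep, this, h2]
      · refine e1.reach (0 + 1) fun k hk hk' => ?_
        rw [hGP k (by omega) (by omega)]
        exact if_neg (by omega)

theorem cmNonTerm_undecidable : ¬ ComputablePred CMNonTerm := by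
  intro h
  obtain ⟨p, hp⟩ := haltProg
  set P := LP.loop 2 (LP.seq p (LP.inc 1)) with hP
  have h1 : ComputablePred fun m : ℕ =>
      ¬ (Nat.Partrec.Code.eval (Denumerable.ofNat Nat.Partrec.Code m) 0).Dom := by
    refine ComputablePred.computable_of_manyOneReducible ⟨_, (mM_primrec P).to_comp, fun m => ?_⟩ h
    rw [mM_nonterm, main_loop hp, haltTest_iff]
  have h2 : ComputablePred fun c : Nat.Partrec.Code => ¬ (Nat.Partrec.Code.eval c 0).Dom := by
    refine ComputablePred.computable_of_manyOneReducible
      ⟨Encodable.encode, Computable.encode, fun c => ?_⟩ h1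
    rw [Denumerable.ofNat_encode]
  exact ComputablePred.halting_problem 0 (h2.not.of_eq fun c => not_not)

/-- For any class `C` of weak orders containing a member with an
`⟨ω+1,>⟩`-type chain, satisfiability over decreasing 2-frames with horizontal
frame in `C` and all vertical frames difference frames is undecidable; the
counter-machine non-termination problem is computably many-one reducible to it. -/
theorem weakOrd_chain_decreasing_undecidable (C : Frame → Prop)
    (hC : ∀ F, C F → WeakOrd F.R)
    (hchain : ∃ F, C F ∧ HasOmegaPlusOneChain F) :
    ¬ ComputablePred (BCodes (DecDiffSat C)) ∧
    ManyOneReducible CMNonTerm (BCodes (DecDiffSat C)) := by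
  exact ⟨fun h => cmNonTerm_undecidable
    (ComputablePred.computable_of_manyOneReducible (manyOne_main hC hchain) h), manyOne_main hC hchain⟩

end HK
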